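/- arXiv:2506.20166 — 11 statements merged into one kernel-verified Lean document; each statement's English description precedes it below -/
import Mathlib

section
/- For all real numbers a and b such that b is not an integer multiple of π, one has arctan(tanh(a)·cot(b)) = Σ_{k=−∞}^{∞} arctan( a / (b + kπ) ), where the bilateral sum exists as the limit of symmetric partial sums. -/
open Real Filter

open Complex in
lemma re_one_div_ofReal_add_mul_I (c y : ℝ) :
    (1 / ((c : ℂ) + y * I)).re = c / (c ^ 2 + y ^ 2) := by
  simp [Complex.normSq_apply, Complex.inv_re, sq]

lemma hasDerivAt_arctan_div {c : ℝ} (hc : c ≠ 0) (y : ℝ) :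
    HasDerivAt (fun t ↦ arctan (t / c)) (c / (c ^ 2 + y ^ 2)) y := by
  convert! ((hasDerivAt_id y).div_const c).arctan using 1
  have : c ^ 2 + y ^ 2 ≠ 0 := by positivity
  have : 1 + (y / c) ^ 2 ≠ 0 := by positivity
  simp only [id]
  field_simp

lemma hasDerivAt_arctan_tanh_mul_cot {b : ℝ} (hb : Real.sin b ≠ 0) (a : ℝ) :
    HasDerivAt (fun t ↦ arctan (Real.tanh t * (Real.cos b / Real.sin b)))
      (Complex.cot (b + a * Complex.I)).re a := by
  have hcosh : Real.cosh a ≠ 0 := (Real.cosh_pos a).ne'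
  have hd : HasDerivAt Real.tanh (1 / Real.cosh a ^ 2) a := by
    have h := (Real.hasDerivAt_sinh a).div (Real.hasDerivAt_cosh a) hcosh
    convert! h using 1
    · ext t; exact Real.tanh_eq_sinh_div_cosh t
    · have := Real.cosh_sq a
      congr 1
      linarith
  convert! (hd.mul_const (Real.cos b / Real.sin b)).arctan using 1
  have hcot : (Complex.cot (b + a * Complex.I)).re = Real.sin b * Real.cos b /
      (Real.sin b ^ 2 * Real.cosh a ^ 2 + Real.cos b ^ 2 * Real.sinh a ^ 2) := by
    rw [Complex.cot, Complex.sin_add_mul_I, Complex.cos_add_mul_I]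
    simp only [← Complex.ofReal_sin, ← Complex.ofReal_cos, ← Complex.ofReal_sinh,
      ← Complex.ofReal_cosh, Complex.div_re, Complex.normSq_apply, Complex.add_re,
      Complex.add_im, Complex.sub_re, Complex.sub_im, Complex.mul_re, Complex.mul_im,
      Complex.ofReal_re, Complex.ofReal_im, Complex.I_re, Complex.I_im]
    rw [← add_div]
    congr 1
    · linear_combination Real.cos b * Real.sin b * Real.cosh_sq a
    · ring
  have h1 : 0 < Real.sin b ^ 2 * Real.cosh a ^ 2 + Real.cos b ^ 2 * Real.sinh a ^ 2 := by
    positivity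
  rw [hcot, Real.tanh_eq_sinh_div_cosh]
  have h2 : 1 + (Real.sinh a / Real.cosh a * (Real.cos b / Real.sin b)) ^ 2 ≠ 0 := by
    positivity
  field_simp

lemma abs_div_add_div_le {c d : ℝ} (hc : c ≠ 0) (hd : d ≠ 0) (y : ℝ) :
    |c / (c ^ 2 + y ^ 2) + d / (d ^ 2 + y ^ 2)| ≤
      |c / (c ^ 2 + 0 ^ 2) + d / (d ^ 2 + 0 ^ 2)| := by
  have hc' : 0 < c ^ 2 + y ^ 2 := by positivity
  have hd' : 0 < d ^ 2 + y ^ 2 := by positivity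
  have e1 : c / (c ^ 2 + y ^ 2) + d / (d ^ 2 + y ^ 2) =
      (c + d) * ((c * d + y ^ 2) / ((c ^ 2 + y ^ 2) * (d ^ 2 + y ^ 2))) := by
    field_simp
    ring
  have e2 : c / (c ^ 2 + 0 ^ 2) + d / (d ^ 2 + 0 ^ 2) = (c + d) * (1 / (c * d)) := by
    rw [zero_pow two_ne_zero, add_zero, add_zero]
    field_simp
    ring
  rw [e1, e2, abs_mul, abs_mul]
  refine mul_le_mul_of_nonneg_left ?_ (abs_nonneg _)
  rw [abs_div, abs_div, abs_one, abs_of_pos (mul_pos hc' hd'),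
    div_le_div_iff₀ (by positivity) (by positivity), ← abs_mul, one_mul, abs_le]
  constructor <;> nlinarith [sq_nonneg (c * d), sq_nonneg (c * y), sq_nonneg (d * y),
    sq_nonneg (y ^ 2), sq_nonneg ((c + d) * y), sq_nonneg ((c - d) * y)]

lemma ofReal_add_mul_I_mem_integerComplement {x : ℝ} (hx : ∀ k : ℤ, x ≠ k) (y : ℝ) :
    (x + y * Complex.I : ℂ) ∈ Complex.integerComplement := by
  rintro ⟨k, hk⟩
  apply hx k
  simpa using (congrArg Complex.re hk).symm

lemma re_cotTerm (x y : ℝ) (n : ℕ) :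
    (cotTerm (x + y * Complex.I) n).re =
      (x - (n + 1)) / ((x - (n + 1)) ^ 2 + y ^ 2) +
        (x + (n + 1)) / ((x + (n + 1)) ^ 2 + y ^ 2) := by
  rw [← re_one_div_ofReal_add_mul_I, ← re_one_div_ofReal_add_mul_I, ← Complex.add_re, cotTerm]
  push_cast
  ring_nf

lemma hasSum_arctan_div_sub_add_arctan_div_add {x : ℝ} (hx : ∀ k : ℤ, x ≠ k) (y : ℝ) :
    HasSum (fun n : ℕ ↦ arctan (y / (x - (n + 1))) + arctan (y / (x + (n + 1))))
      (arctan (tanh (π * y) * (cos (π * x) / sin (π * x))) - arctan (y / x)) := by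
  have hx0 : x ≠ 0 := by simpa using hx 0
  have hm (n : ℕ) : x - (n + 1) ≠ 0 := sub_ne_zero.2 (by exact_mod_cast hx (n + 1))
  have hp (n : ℕ) : x + (n + 1) ≠ 0 := fun h ↦ hx (-(n + 1)) (by push_cast; linarith)
  have hsin : sin (π * x) ≠ 0 := by
    intro h
    obtain ⟨k, hk⟩ := Real.sin_eq_zero_iff.1 h
    exact hx k (mul_left_cancel₀ Real.pi_ne_zero (by linarith))
  set g : ℕ → ℝ → ℝ := fun n t ↦ arctan (t / (x - (n + 1))) + arctan (t / (x + (n + 1)))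
  have hz := ofReal_add_mul_I_mem_integerComplement hx
  have hu : Summable fun n : ℕ ↦ ‖cotTerm (x + (0 : ℝ) * Complex.I) n‖ :=
    (summable_cotTerm (hz 0)).norm
  have hg (n : ℕ) (t : ℝ) : HasDerivAt (g n) (cotTerm (x + t * Complex.I) n).re t := by
    rw [re_cotTerm]
    exact (hasDerivAt_arctan_div (hm n) t).add (hasDerivAt_arctan_div (hp n) t)
  have hg' (n : ℕ) (t : ℝ) : ‖(cotTerm (x + t * Complex.I) n).re‖ ≤
      ‖cotTerm (x + (0 : ℝ) * Complex.I) n‖ := by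
    refine le_trans ?_ (Complex.abs_re_le_norm _)
    rw [re_cotTerm, re_cotTerm, Real.norm_eq_abs]
    exact abs_div_add_div_le (hm n) (hp n) t
  have hg0 : Summable fun n ↦ g n 0 := by simp [g]
  have hsum (t : ℝ) : Summable fun n ↦ g n t := summable_of_summable_hasDerivAt hu hg hg' hg0 t
  have hF (t : ℝ) : HasDerivAt (fun t ↦ arctan (t / x) + ∑' n, g n t)
      (π * Complex.cot (π * (x + t * Complex.I))).re t := by
    convert! (hasDerivAt_arctan_div hx0 t).add (hasDerivAt_tsum hu hg hg' hg0 t) using 1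
    rw [← Complex.re_tsum (summable_cotTerm (hz t)), ← cot_series_rep' (hz t), Complex.sub_re,
      re_one_div_ofReal_add_mul_I]
    ring
  have hG (t : ℝ) : HasDerivAt (fun t ↦ arctan (tanh (π * t) * (cos (π * x) / sin (π * x))))
      (π * Complex.cot (π * (x + t * Complex.I))).re t := by
    convert! (hasDerivAt_arctan_tanh_mul_cot hsin (π * t)).comp t
      ((hasDerivAt_id t).const_mul π) using 1
    rw [Complex.re_ofReal_mul]
    push_cast
    ring_nf
  have hFG := is_const_of_deriv_eq_zero
    (fun t ↦ ((hF t).sub (hG t)).differentiableAt)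
    (fun t ↦ by rw [((hF t).sub (hG t)).deriv, sub_self]) y 0
  have hFG' : arctan (y / x) + ∑' n, g n y =
      arctan (tanh (π * y) * (cos (π * x) / sin (π * x))) := by
    simpa [g, sub_eq_zero] using hFG
  rw [← hFG', add_sub_cancel_left]
  exact (hsum y).hasSum

lemma sum_Icc_neg_natCast_eq_add_sum_range (f : ℤ → ℝ) (N : ℕ) :
    ∑ k ∈ Finset.Icc (-(N : ℤ)) N, f k =
      f 0 + ∑ n ∈ Finset.range N, (f (-(n + 1)) + f (n + 1)) := by
  induction N with
  | zero => simp
  | succ N ih =>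
    rw [Nat.cast_add, Nat.cast_one, Finset.Icc_succ_succ, Finset.sum_union (by simp),
      Finset.sum_pair (by lia), ih, Finset.sum_range_succ]
    ring

/-- Euler–Ramanujan identity: for `b` not an integer multiple of `π`, the symmetric
partial sums `∑_{k=-N}^{N} arctan (a / (b + kπ))` converge to
`arctan (tanh a · cot b)`. -/
theorem euler_ramanujan_identity (a b : ℝ) (hb : ∀ k : ℤ, b ≠ k * Real.pi) :
    Filter.Tendsto
      (fun N : ℕ => ∑ k ∈ Finset.Icc (-(N : ℤ)) (N : ℤ),
        Real.arctan (a / (b + k * Real.pi)))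
      Filter.atTop
      (nhds (Real.arctan (Real.tanh a * (Real.cos b / Real.sin b)))) := by
  have hx (k : ℤ) : b / π ≠ k := fun h ↦ hb k ((div_eq_iff Real.pi_ne_zero).1 h)
  have h := (hasSum_arctan_div_sub_add_arctan_div_add hx (a / π)).tendsto_sum_nat.const_add
    (arctan (a / π / (b / π)))
  rw [add_sub_cancel, mul_div_cancel₀ a Real.pi_ne_zero, mul_div_cancel₀ b Real.pi_ne_zero] at h
  have key (k : ℝ) : a / π / (b / π + k) = a / (b + k * π) := by
    rw [div_div, mul_add, mul_div_cancel₀ b Real.pi_ne_zero, mul_comm π k]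
  refine h.congr fun N ↦ ?_
  rw [sum_Icc_neg_natCast_eq_add_sum_range]
  simp only [sub_eq_add_neg, key]
  congr 2
  · simpa using key 0
  · push_cast
    rfl
end

section
/- For all real numbers a and b such that b is not an integer multiple of π, and every positive integer n, one has Σ_{k=−∞}^{∞} arctan( a / (b + kπ) ) = Σ_{m=0}^{n−1} arctan( tanh(a/n)·cot((b + mπ)/n) ), where the bilateral sum on the left exists as the limit of symmetric partial sums. -/
open Real Filter

theorem Finset.sum_Icc_neg_natCast {M : Type*} [AddCommGroup M] (f : ℤ → M) (N : ℕ) :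
    ∑ k ∈ Finset.Icc (-(N : ℤ)) N, f k =
      f 0 + ∑ k ∈ Finset.range N, (f (k + 1) + f (-(k + 1))) := by
  induction N with
  | zero => simp
  | succ N ih =>
    rw [Nat.cast_add, Nat.cast_one, Finset.sum_Icc_succ_eq_add_endpoints, ih,
      Finset.sum_range_succ]
    abel

theorem Finset.sum_Icc_add_natCast {M : Type*} [AddCommMonoid M] (f : ℤ → M) {l u : ℤ}
    (h : l ≤ u) (r : ℕ) :
    ∑ k ∈ Finset.Icc l (u + r), f k =
      ∑ k ∈ Finset.Icc l u, f k + ∑ i ∈ Finset.range r, f (u + i + 1) := by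
  induction r with
  | zero => simp
  | succ r ih =>
    rw [Nat.cast_add, Nat.cast_one, ← add_assoc,
      ← Finset.insert_Icc_right_eq_Icc_add_one (by lia), Finset.sum_insert (by simp), ih,
      Finset.sum_range_succ, add_comm, add_assoc]

theorem Finset.sum_Icc_residues {M : Type*} [AddCommMonoid M] (f : ℤ → M) (r N : ℕ) :
    ∑ m ∈ Finset.range (r + 1), ∑ j ∈ Finset.Icc (-(N : ℤ)) N, f (((r + 1 : ℕ) : ℤ) * j + m) =
      ∑ k ∈ Finset.Icc (-(((r + 1) * N : ℕ) : ℤ)) (((r + 1) * N : ℕ) + r), f k := by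
  rw [← Finset.sum_product']
  have hpos : (0 : ℤ) < ((r + 1 : ℕ) : ℤ) := by positivity
  refine Finset.sum_bij' (fun p _ => ((r + 1 : ℕ) : ℤ) * p.2 + p.1)
    (fun k _ => ((k % ((r + 1 : ℕ) : ℤ)).toNat, k / ((r + 1 : ℕ) : ℤ))) ?_ ?_ ?_ ?_ ?_
  · rintro ⟨m, j⟩ h
    simp only [Finset.mem_product, Finset.mem_range, Finset.mem_Icc] at h ⊢
    push_cast
    constructor <;> nlinarith
  · intro k h
    simp only [Finset.mem_product, Finset.mem_range, Finset.mem_Icc] at h ⊢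
    have h1 := Int.emod_nonneg k hpos.ne'
    have h2 := Int.emod_lt_of_pos k hpos
    refine ⟨by lia, ?_, ?_⟩
    · rw [Int.le_ediv_iff_mul_le hpos]
      push_cast at h ⊢
      linarith
    · rw [← Int.lt_add_one_iff, Int.ediv_lt_iff_lt_mul hpos]
      push_cast at h ⊢
      linarith
  · rintro ⟨m, j⟩ h
    simp only [Finset.mem_product, Finset.mem_range, Finset.mem_Icc] at h
    have hm : ((m : ℤ)) < ((r + 1 : ℕ) : ℤ) := by exact_mod_cast h.1
    simp only [Prod.mk.injEq]
    rw [Int.mul_add_emod_self_left, Int.emod_eq_of_lt (by lia) hm,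
      Int.mul_add_ediv_left _ _ hpos.ne', Int.ediv_eq_zero_of_lt (by lia) hm]
    simp
  · intro k h
    simp only
    rw [Int.toNat_of_nonneg (Int.emod_nonneg k hpos.ne')]
    exact Int.mul_ediv_add_emod k _
  · intros
    rfl

theorem Complex.div_pi_mem_integerComplement {z : ℂ} (hz : ∀ k : ℤ, z ≠ k * π) :
    z / π ∈ Complex.integerComplement := by
  rintro ⟨k, hk⟩
  refine hz k ?_
  have hpi : (π : ℂ) ≠ 0 := by exact_mod_cast Real.pi_ne_zero
  rw [hk]
  field_simp

theorem Complex.hasSum_cot_sub_inv {z : ℂ} (hz : ∀ k : ℤ, z ≠ k * π) :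
    HasSum (fun n : ℕ => 1 / (z - (n + 1) * π) + 1 / (z + (n + 1) * π))
      (Complex.cot z - 1 / z) := by
  have hpi : (π : ℂ) ≠ 0 := by exact_mod_cast Real.pi_ne_zero
  have hx := Complex.div_pi_mem_integerComplement hz
  have h := (summable_cotTerm hx).hasSum
  rw [← cot_series_rep' hx] at h
  have hlim : (1 / (π : ℂ)) * (π * Complex.cot (π * (z / π)) - 1 / (z / π)) =
      Complex.cot z - 1 / z := by
    rw [mul_div_cancel₀ z hpi]
    field_simp
  rw [← hlim]
  refine (h.mul_left (1 / (π : ℂ))).congr_fun fun n => ?_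
  have h1 : z / π - (n + 1) = (z - (n + 1) * π) / π := by field_simp
  have h2 : z / π + (n + 1) = (z + (n + 1) * π) / π := by field_simp
  rw [cotTerm, h1, h2, one_div_div, one_div_div]
  field_simp

theorem Complex.re_cot_add_mul_I (a b : ℝ) :
    (Complex.cot (b + a * Complex.I)).re =
      Real.sin b * Real.cos b / (Real.sin b ^ 2 + Real.sinh a ^ 2) := by
  have hs : Complex.sin (b + a * Complex.I) =
      ((Real.sin b * Real.cosh a : ℝ) : ℂ) + ((Real.cos b * Real.sinh a : ℝ) : ℂ) * Complex.I := by
    rw [Complex.sin_add_mul_I]; push_cast; ring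
  have hc : Complex.cos (b + a * Complex.I) =
      ((Real.cos b * Real.cosh a : ℝ) : ℂ) + ((-(Real.sin b * Real.sinh a) : ℝ) : ℂ) * Complex.I := by
    rw [Complex.cos_add_mul_I]; push_cast; ring
  rw [Complex.cot, hs, hc, Complex.div_re, Complex.normSq_add_mul_I]
  simp only [Complex.add_re, Complex.add_im, Complex.ofReal_re, Complex.ofReal_im,
    Complex.re_ofReal_mul, Complex.im_ofReal_mul, Complex.I_re, Complex.I_im]
  have hden : (Real.sin b * Real.cosh a) ^ 2 + (Real.cos b * Real.sinh a) ^ 2 =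
      Real.sin b ^ 2 + Real.sinh a ^ 2 := by
    rw [mul_pow, mul_pow, Real.cosh_sq, Real.cos_sq']; ring
  rw [hden, ← add_div]
  congr 1
  linear_combination Real.sin b * Real.cos b * Real.cosh_sq a

theorem Complex.re_one_div_add_mul_I (a u : ℝ) :
    (1 / (u + a * Complex.I : ℂ)).re = u / (u ^ 2 + a ^ 2) := by
  rw [Complex.div_re, Complex.normSq_add_mul_I]
  simp

theorem hasSum_re_cot_sub_inv {b : ℝ} (hb : ∀ k : ℤ, b ≠ k * π) (a : ℝ) :
    HasSum (fun n : ℕ => (b + (n + 1) * π) / ((b + (n + 1) * π) ^ 2 + a ^ 2) +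
        (b - (n + 1) * π) / ((b - (n + 1) * π) ^ 2 + a ^ 2))
      (sin b * cos b / (sin b ^ 2 + sinh a ^ 2) - b / (b ^ 2 + a ^ 2)) := by
  have hz : ∀ k : ℤ, (b + a * Complex.I : ℂ) ≠ k * π := by
    intro k hk
    refine hb k ?_
    simpa using congrArg Complex.re hk
  have h := Complex.hasSum_re (Complex.hasSum_cot_sub_inv hz)
  rw [Complex.sub_re, Complex.re_cot_add_mul_I, Complex.re_one_div_add_mul_I] at h
  convert h using 2 with n
  rw [Complex.add_re, ← Complex.re_one_div_add_mul_I a (b + _),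
    ← Complex.re_one_div_add_mul_I a (b - _), add_comm]
  push_cast
  rw [add_right_comm, sub_add_eq_add_sub]

theorem hasDerivAt_arctan_div_s1 {u : ℝ} (hu : u ≠ 0) (a : ℝ) :
    HasDerivAt (fun x => arctan (x / u)) (u / (u ^ 2 + a ^ 2)) a := by
  have h := ((hasDerivAt_id' a).div_const u).arctan
  convert h using 1
  have : u ^ 2 + a ^ 2 ≠ 0 := by positivity
  field_simp

theorem hasDerivAt_arctan_tanh_mul_cot_s1 {b : ℝ} (hb : sin b ≠ 0) (a : ℝ) :
    HasDerivAt (fun x => arctan (tanh x * (cos b / sin b)))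
      (sin b * cos b / (sin b ^ 2 + sinh a ^ 2)) a := by
  have hc : cosh a ≠ 0 := (cosh_pos a).ne'
  have ht : HasDerivAt tanh (1 / cosh a ^ 2) a := by
    have h := (hasDerivAt_sinh a).div (hasDerivAt_cosh a) hc
    rw [show (tanh : ℝ → ℝ) = sinh / cosh from funext tanh_eq_sinh_div_cosh]
    rwa [← sq, ← sq, cosh_sq_sub_sinh_sq] at h
  convert (ht.mul_const (cos b / sin b)).arctan using 1
  have h1 : sin b ^ 2 + sinh a ^ 2 ≠ 0 := by positivity
  have h2 : cosh a ^ 2 * sin b ^ 2 + sinh a ^ 2 * cos b ^ 2 = sin b ^ 2 + sinh a ^ 2 := by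
    rw [cosh_sq, cos_sq']; ring
  rw [tanh_eq_sinh_div_cosh, ← h2]
  rw [← h2] at h1
  field_simp

theorem summable_inv_add_mul_sub {b : ℝ} (hb : ∀ k : ℤ, b ≠ k * π) :
    Summable fun n : ℕ => |1 / ((b + (n + 1) * π) * (b - (n + 1) * π))| := by
  have hb0 : b ≠ 0 := by simpa using hb 0
  refine (((hasSum_re_cot_sub_inv hb 0).summable.mul_left (1 / (2 * b))).congr fun n => ?_).abs
  have hu : b + (n + 1) * π ≠ 0 := fun h => hb (-(n + 1)) (by push_cast; linarith)
  have hv : b - (n + 1) * π ≠ 0 := fun h => hb (n + 1) (by push_cast; linarith)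
  field_simp
  ring

theorem abs_div_sq_add_div_sq_le {u v a R : ℝ} (hu : u ≠ 0) (hv : v ≠ 0) (ha : |a| ≤ R) :
    |u / (u ^ 2 + a ^ 2) + v / (v ^ 2 + a ^ 2)| ≤
      |u + v| * (|1 / (u * v)| + R ^ 2 * |1 / (u * v)| ^ 2) := by
  have hu' : u ^ 2 + a ^ 2 ≠ 0 := by positivity
  have hv' : v ^ 2 + a ^ 2 ≠ 0 := by positivity
  have huv : 0 < |u * v| := by positivity
  have haR : a ^ 2 ≤ R ^ 2 := sq_le_sq' (by linarith [neg_abs_le a]) (by linarith [le_abs_self a])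
  have h1 : u / (u ^ 2 + a ^ 2) + v / (v ^ 2 + a ^ 2) =
      (u + v) * ((u * v + a ^ 2) / ((u ^ 2 + a ^ 2) * (v ^ 2 + a ^ 2))) := by
    field_simp
    ring
  have h2 : |1 / (u * v)| + R ^ 2 * |1 / (u * v)| ^ 2 = (|u * v| + R ^ 2) / |u * v| ^ 2 := by
    rw [abs_div, abs_one]
    field_simp
  rw [h1, h2, abs_mul, abs_div]
  gcongr
  · calc |u * v + a ^ 2| ≤ |u * v| + |a ^ 2| := abs_add_le _ _
      _ ≤ |u * v| + R ^ 2 := by rw [abs_of_nonneg (sq_nonneg a)]; gcongr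
  · rw [sq_abs, abs_of_nonneg (by positivity)]
    nlinarith [mul_nonneg (sq_nonneg u) (sq_nonneg a), mul_nonneg (sq_nonneg v) (sq_nonneg a),
      mul_nonneg (sq_nonneg a) (sq_nonneg a)]

theorem hasSum_arctan_pairs {b : ℝ} (hb : ∀ k : ℤ, b ≠ k * π) (a : ℝ) :
    HasSum (fun n : ℕ => arctan (a / (b + (n + 1) * π)) + arctan (a / (b - (n + 1) * π)))
      (arctan (tanh a * (cos b / sin b)) - arctan (a / b)) := by
  have hb0 : b ≠ 0 := by simpa using hb 0
  have hu : ∀ n : ℕ, b + (n + 1) * π ≠ 0 := fun n h =>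
    hb (-(n + 1)) (by push_cast; linarith)
  have hv : ∀ n : ℕ, b - (n + 1) * π ≠ 0 := fun n h =>
    hb (n + 1) (by push_cast; linarith)
  have hs : sin b ≠ 0 := by
    rw [Ne, sin_eq_zero_iff]
    rintro ⟨k, hk⟩
    exact hb k hk.symm
  set g : ℕ → ℝ → ℝ := fun n x =>
    arctan (x / (b + (n + 1) * π)) + arctan (x / (b - (n + 1) * π))
  have hg : ∀ n x, HasDerivAt (g n) ((b + (n + 1) * π) / ((b + (n + 1) * π) ^ 2 + x ^ 2) +
      (b - (n + 1) * π) / ((b - (n + 1) * π) ^ 2 + x ^ 2)) x := fun n x =>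
    (hasDerivAt_arctan_div_s1 (hu n) x).add (hasDerivAt_arctan_div_s1 (hv n) x)
  have hg0 : Summable fun n => g n 0 := by simp [g, summable_zero]
  have hS := summable_inv_add_mul_sub hb
  have hS2 : Summable fun n : ℕ => |1 / ((b + (n + 1) * π) * (b - (n + 1) * π))| ^ 2 :=
    ((hS.mul_of_nonneg hS (fun _ => abs_nonneg _) fun _ => abs_nonneg _).comp_injective
      (i := fun n => (n, n)) fun _ _ h => congrArg Prod.fst h).congr fun n => (sq _).symm
  have hbound (R : ℝ) := (hS.add (hS2.mul_left (R ^ 2))).mul_left |2 * b|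
  have hg' : ∀ (R : ℝ) (n : ℕ), ∀ x ∈ Metric.ball (0 : ℝ) R,
      ‖(b + (n + 1) * π) / ((b + (n + 1) * π) ^ 2 + x ^ 2) +
        (b - (n + 1) * π) / ((b - (n + 1) * π) ^ 2 + x ^ 2)‖ ≤
      |2 * b| * (|1 / ((b + (n + 1) * π) * (b - (n + 1) * π))| +
        R ^ 2 * |1 / ((b + (n + 1) * π) * (b - (n + 1) * π))| ^ 2) := by
    intro R n x hx
    have hx' : |x| ≤ R := by simpa using (mem_ball_zero_iff.mp hx).le
    rw [show 2 * b = (b + (n + 1) * π) + (b - (n + 1) * π) by ring]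
    exact abs_div_sq_add_div_sq_le (hu n) (hv n) hx'
  have hconn (R : ℝ) : IsPreconnected (Metric.ball (0 : ℝ) R) :=
    (convex_ball (0 : ℝ) R).isPreconnected
  have hmem (x : ℝ) : x ∈ Metric.ball (0 : ℝ) (|x| + 1) := by simp
  have hmem0 (x : ℝ) : (0 : ℝ) ∈ Metric.ball (0 : ℝ) (|x| + 1) := by
    simp only [Metric.mem_ball, dist_self]; positivity
  have hsum (x : ℝ) : Summable fun n => g n x :=
    summable_of_summable_hasDerivAt_of_isPreconnected (hbound _) Metric.isOpen_ball (hconn _)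
      (fun n y _ => hg n y) (hg' (|x| + 1)) (hmem0 x) hg0 (hmem x)
  have hderiv (x : ℝ) : HasDerivAt (fun y => ∑' n, g n y)
      (sin b * cos b / (sin b ^ 2 + sinh x ^ 2) - b / (b ^ 2 + x ^ 2)) x := by
    rw [← (hasSum_re_cot_sub_inv hb x).tsum_eq]
    exact hasDerivAt_tsum_of_isPreconnected (hbound _) Metric.isOpen_ball (hconn _)
      (fun n y _ => hg n y) (hg' (|x| + 1)) (hmem0 x) hg0 (hmem x)
  have hdiff (x : ℝ) := (hderiv x).sub
    ((hasDerivAt_arctan_tanh_mul_cot_s1 hs x).sub (hasDerivAt_arctan_div_s1 hb0 x))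
  simp only [sub_self] at hdiff
  have hconst := is_const_of_deriv_eq_zero (fun x => (hdiff x).differentiableAt)
    (fun x => (hdiff x).deriv) a 0
  simp only [Pi.sub_apply, g, zero_div, arctan_zero, tanh_zero, zero_mul, add_zero, tsum_zero,
    sub_self] at hconst
  rw [← sub_eq_zero.mp hconst]
  exact (hsum a).hasSum

theorem tendsto_sum_arctan_div_add_int_mul_pi {b : ℝ} (hb : ∀ k : ℤ, b ≠ k * π) (a : ℝ) :
    Tendsto (fun N : ℕ => ∑ k ∈ Finset.Icc (-(N : ℤ)) N, arctan (a / (b + k * π))) atTop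
      (nhds (arctan (tanh a * (cos b / sin b)))) := by
  have h := ((hasSum_arctan_pairs hb a).tendsto_sum_nat).const_add (arctan (a / b))
  rw [add_sub_cancel] at h
  refine h.congr fun N => ?_
  rw [Finset.sum_Icc_neg_natCast]
  push_cast
  simp only [zero_mul, add_zero, neg_mul, ← sub_eq_add_neg]

theorem tendsto_arctan_div_add_natCast_mul_pi (a b : ℝ) :
    Tendsto (fun N : ℕ => arctan (a / (b + N * π))) atTop (nhds 0) := by
  have h : Tendsto (fun N : ℕ => a / (b + N * π)) atTop (nhds 0) :=
    tendsto_const_nhds.div_atTop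
      (tendsto_atTop_add_const_left _ _ (tendsto_natCast_atTop_atTop.atTop_mul_const pi_pos))
  simpa [Function.comp_def] using (continuous_arctan.tendsto 0).comp h

/-- Finite regrouping of the Euler–Ramanujan bilateral sum: for `b` not an integer
multiple of `π` and `n` a positive integer, the symmetric partial sums
`∑_{k=-N}^{N} arctan (a / (b + kπ))` converge to
`∑_{m=0}^{n-1} arctan (tanh (a/n) · cot ((b + mπ)/n))`. -/
theorem euler_ramanujan_finite_regrouping (a b : ℝ) (hb : ∀ k : ℤ, b ≠ k * Real.pi)
    (n : ℕ) (hn : 0 < n) :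
    Filter.Tendsto
      (fun N : ℕ => ∑ k ∈ Finset.Icc (-(N : ℤ)) (N : ℤ),
        Real.arctan (a / (b + k * Real.pi)))
      Filter.atTop
      (nhds (∑ m ∈ Finset.range n,
        Real.arctan (Real.tanh (a / n) *
          (Real.cos ((b + m * Real.pi) / n) / Real.sin ((b + m * Real.pi) / n))))) := by
  obtain ⟨r, rfl⟩ : ∃ r, n = r + 1 := ⟨n - 1, by lia⟩
  have hn0 : ((r + 1 : ℕ) : ℝ) ≠ 0 := by positivity
  have hbm : ∀ (m : ℕ) (k : ℤ), (b + m * π) / ((r + 1 : ℕ) : ℝ) ≠ k * π := by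
    intro m k h
    rw [div_eq_iff hn0] at h
    refine hb (k * (r + 1 : ℕ) - m) ?_
    push_cast at h ⊢
    linarith
  have hR := tendsto_finsetSum (Finset.range (r + 1)) fun m _ =>
    tendsto_sum_arctan_div_add_int_mul_pi (hbm m) (a / ((r + 1 : ℕ) : ℝ))
  have hL := tendsto_sum_arctan_div_add_int_mul_pi hb a
  have hsub : Tendsto (fun N : ℕ => (r + 1) * N) atTop atTop :=
    tendsto_id.const_mul_atTop' (Nat.succ_pos r)
  have hT : Tendsto (fun N : ℕ => ∑ i ∈ Finset.range r,
      arctan (a / (b + ((((r + 1) * N : ℕ) : ℤ) + i + 1 : ℤ) * π))) atTop (nhds 0) := by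
    rw [← Finset.sum_const_zero (s := Finset.range r)]
    refine tendsto_finsetSum _ fun i _ => ?_
    refine ((tendsto_arctan_div_add_natCast_mul_pi a b).comp
      ((tendsto_add_atTop_nat (i + 1)).comp hsub)).congr fun N => ?_
    simp only [Function.comp_apply]
    push_cast
    simp only [add_assoc]
  have h := (hL.comp hsub).add hT
  rw [add_zero] at h
  rw [← tendsto_nhds_unique h (hR.congr fun N => ?_)]
  · exact hL
  · simp only [Function.comp_apply]
    rw [← Finset.sum_Icc_add_natCast (fun k : ℤ => arctan (a / (b + k * π))) (by lia) r,
      ← Finset.sum_Icc_residues]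
    refine Finset.sum_congr rfl fun m _ => Finset.sum_congr rfl fun j _ => ?_
    congr 1
    rw [div_add' _ _ _ hn0, div_div_div_cancel_right₀ hn0]
    push_cast
    ring_nf
end

section
/- Let θ ∈ (0, π/2) and set s := π / sin(θ/2). Let x, y ∈ ℝ satisfy cos(x·(sin θ)/2) ≠ 0, y ≠ 0, and tan(x·(sin θ)/2) / tanh(y·sin(θ/2)) > 0. Then x·cos(θ/2) − n·s ≠ 0 for every integer n, the bilateral sum below converges as the limit of symmetric partial sums, and ψ(x, y; θ) = sec(θ/2)·[ π/2 − Σ_{n=−∞}^{∞} arctan( y / (x·cos(θ/2) − n·s) ) ]. -/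
open Real Filter

/-- Height function of the one-parameter family of Scherk's maximal surfaces. -/
noncomputable def psi (x y θ : ℝ) : ℝ :=
  (Real.cos (θ / 2))⁻¹ *
    Real.arctan (Real.tan (x * Real.sin θ / 2) / Real.tanh (y * Real.sin (θ / 2)))

theorem abs_arctan_add_arctan_le (u v : ℝ) : |arctan u + arctan v| ≤ |u + v| := by
  have h : LipschitzWith 1 arctan := by
    refine lipschitzWith_of_nnnorm_deriv_le differentiable_arctan fun x => ?_
    rw [← NNReal.coe_le_coe, coe_nnnorm, Real.deriv_arctan, Real.norm_eq_abs,
      abs_of_nonneg (by positivity)]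
    exact (div_le_one (by positivity)).2 (by nlinarith [sq_nonneg x])
  have := h.dist_le_mul u (-v)
  simpa [Real.dist_eq, arctan_neg] using this

theorem one_add_mul_I_eq_norm_mul_exp (t : ℝ) :
    (1 + t * Complex.I : ℂ) = ‖(1 + t * Complex.I : ℂ)‖ * Complex.exp (arctan t * Complex.I) := by
  have hn : ‖(1 + t * Complex.I : ℂ)‖ = √(1 + t ^ 2) := by
    simpa using Complex.norm_add_mul_I 1 t
  have hs : √(1 + t ^ 2) ≠ 0 := by positivity
  rw [hn, Complex.exp_mul_I, ← Complex.ofReal_cos, ← Complex.ofReal_sin, cos_arctan, sin_arctan]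
  have hs' : ((√(1 + t ^ 2) : ℝ) : ℂ) ≠ 0 := by exact_mod_cast hs
  push_cast
  field_simp

/-- The sum of the terms of index `n + 1` and `-(n + 1)` in `∑ n, arctan (b / (a - n))`. -/
noncomputable def arctanPair (a b : ℝ) (n : ℕ) : ℝ :=
  arctan (b / (a - (n + 1))) + arctan (b / (a + (n + 1)))

theorem sum_Icc_arctan_eq (a b : ℝ) (N : ℕ) :
    ∑ n ∈ Finset.Icc (-(N : ℤ)) (N : ℤ), arctan (b / (a - n)) =
      arctan (b / a) + ∑ n ∈ Finset.range N, arctanPair a b n := by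
  induction N with
  | zero => simp
  | succ N ih =>
    have h : Finset.Icc (-((N + 1 : ℕ) : ℤ)) ((N + 1 : ℕ) : ℤ) =
        insert ((N : ℤ) + 1) (insert (-((N : ℤ) + 1)) (Finset.Icc (-(N : ℤ)) (N : ℤ))) := by
      ext k
      simp only [Finset.mem_Icc, Finset.mem_insert]
      omega
    rw [h, Finset.sum_insert, Finset.sum_insert, ih, Finset.sum_range_succ, arctanPair]
    · push_cast
      rw [sub_neg_eq_add]
      ring
    · simp only [Finset.mem_Icc]
      omega
    · simp only [Finset.mem_Icc, Finset.mem_insert]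
      omega

theorem ofReal_mem_integerComplement {a : ℝ} (ha : ∀ n : ℤ, a - n ≠ 0) :
    (a : ℂ) ∈ Complex.integerComplement := by
  rintro ⟨n, hn⟩
  have h : (n : ℝ) = a := by exact_mod_cast hn
  exact ha n (sub_eq_zero.2 h.symm)

theorem norm_arctanPair_le {a b : ℝ} {M : ℝ} (hb : |b| ≤ M) (n : ℕ) :
    ‖arctanPair a b n‖ ≤ M * ‖cotTerm a n‖ := by
  have h : ‖cotTerm a n‖ = |1 / (a - (n + 1)) + 1 / (a + (n + 1))| := by
    rw [cotTerm, ← Real.norm_eq_abs, ← Complex.norm_real]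
    push_cast
    rfl
  rw [h, Real.norm_eq_abs]
  refine (abs_arctan_add_arctan_le _ _).trans ?_
  rw [div_eq_mul_one_div b, div_eq_mul_one_div b (a + _), ← mul_add, abs_mul]
  gcongr

theorem summable_arctanPair {a : ℝ} (ha : ∀ n : ℤ, a - n ≠ 0) (b : ℝ) :
    Summable (arctanPair a b) :=
  .of_norm_bounded ((summable_cotTerm (ofReal_mem_integerComplement ha)).norm.mul_left |b|)
    fun n => norm_arctanPair_le le_rfl n

/-- The limit of the symmetric partial sums of `∑ n, arctan (b / (a - n))`. -/
noncomputable def arctanSeries (a b : ℝ) : ℝ :=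
  arctan (b / a) + ∑' n, arctanPair a b n

theorem tendsto_sum_Icc_arctan {a : ℝ} (ha : ∀ n : ℤ, a - n ≠ 0) (b : ℝ) :
    Tendsto (fun N : ℕ => ∑ n ∈ Finset.Icc (-(N : ℤ)) (N : ℤ), arctan (b / (a - n))) atTop
      (nhds (arctanSeries a b)) := by
  simp_rw [sum_Icc_arctan_eq]
  exact (summable_arctanPair ha b).hasSum.tendsto_sum_nat.const_add _

theorem continuous_arctanSeries {a : ℝ} (ha : ∀ n : ℤ, a - n ≠ 0) :
    Continuous (arctanSeries a) := by
  have h : Continuous fun b => ∑' n, arctanPair a b n := by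
    refine continuous_iff_continuousAt.2 fun b => ?_
    have hc : ContinuousOn (fun b => ∑' n, arctanPair a b n) (Metric.ball 0 (|b| + 1)) := by
      refine continuousOn_tsum (fun n => ?_)
        ((summable_cotTerm (ofReal_mem_integerComplement ha)).norm.mul_left (|b| + 1))
        fun n c hc => norm_arctanPair_le (by simpa using (mem_ball_zero_iff.1 hc).le) n
      unfold arctanPair
      fun_prop
    exact hc.continuousAt (Metric.isOpen_ball.mem_nhds (by simp))
  unfold arctanSeries
  fun_prop

/-- Partial products of Euler's product for `sin (π * z)`. -/
noncomputable def eulerSinPartial (N : ℕ) (z : ℂ) : ℂ :=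
  π * z * ∏ j ∈ Finset.range N, (1 - z ^ 2 / ((j : ℂ) + 1) ^ 2)

theorem eulerSinPartial_ratio {a : ℝ} (ha : ∀ n : ℤ, a - n ≠ 0) (b : ℝ) (N : ℕ) :
    eulerSinPartial N (a + b * Complex.I) / eulerSinPartial N a =
      ‖eulerSinPartial N (a + b * Complex.I) / eulerSinPartial N a‖ *
        Complex.exp
          ((arctan (b / a) + ∑ n ∈ Finset.range N, arctanPair a b n : ℝ) * Complex.I) := by
  have ha0 : (a : ℂ) ≠ 0 := by
    have := ha 0
    exact_mod_cast (by simpa using this : a ≠ 0)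
  have hpi : (π : ℂ) ≠ 0 := by exact_mod_cast pi_ne_zero
  induction N with
  | zero =>
    have h : eulerSinPartial 0 (a + b * Complex.I) / eulerSinPartial 0 a =
        1 + ((b / a : ℝ) : ℂ) * Complex.I := by
      simp only [eulerSinPartial, Finset.range_zero, Finset.prod_empty]
      push_cast
      field_simp
    rw [h]
    simpa using one_add_mul_I_eq_norm_mul_exp (b / a)
  | succ N ih =>
    have h1 : (a : ℂ) - (N + 1) ≠ 0 := by
      have := ha (N + 1)
      exact_mod_cast this
    have h2 : (a : ℂ) + (N + 1) ≠ 0 := by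
      have := ha (-(N + 1))
      push_cast at this
      rw [sub_neg_eq_add] at this
      exact_mod_cast this
    have h3 : (N : ℂ) + 1 ≠ 0 := by exact_mod_cast N.succ_ne_zero
    have hfac : ∀ z : ℂ, 1 - z ^ 2 / ((N : ℂ) + 1) ^ 2 =
        -(z - (N + 1)) * (z + (N + 1)) / ((N : ℂ) + 1) ^ 2 := by
      intro z
      field_simp
      ring
    have hstep : eulerSinPartial (N + 1) (a + b * Complex.I) / eulerSinPartial (N + 1) a =
        eulerSinPartial N (a + b * Complex.I) / eulerSinPartial N a *
          ((1 + ((b / (a - (N + 1)) : ℝ) : ℂ) * Complex.I) *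
            (1 + ((b / (a + (N + 1)) : ℝ) : ℂ) * Complex.I)) := by
      simp only [eulerSinPartial, Finset.prod_range_succ]
      rw [← mul_assoc, ← mul_assoc, mul_div_mul_comm]
      congr 1
      rw [hfac, hfac]
      push_cast
      field_simp
      ring
    rw [hstep, norm_mul, norm_mul]
    conv_lhs =>
      rw [ih, one_add_mul_I_eq_norm_mul_exp (b / (a - (N + 1))),
        one_add_mul_I_eq_norm_mul_exp (b / (a + (N + 1)))]
    rw [Finset.sum_range_succ, arctanPair]
    push_cast
    simp only [add_mul, Complex.exp_add]
    ring

theorem sin_pi_mul_ne_zero_of_forall_sub_ne_zero {a : ℝ} (ha : ∀ n : ℤ, a - n ≠ 0) :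
    sin (π * a) ≠ 0 := by
  rw [Real.sin_ne_zero_iff]
  intro n hn
  refine ha n (sub_eq_zero.2 ?_)
  exact mul_left_cancel₀ pi_ne_zero (by linarith)

theorem cos_arctanSeries_sub_eq_one {a : ℝ} (ha : ∀ n : ℤ, a - n ≠ 0) (b : ℝ) :
    cos (arctanSeries a b - arctan (tanh (π * b) * (cos (π * a) / sin (π * a)))) = 1 := by
  have hs := sin_pi_mul_ne_zero_of_forall_sub_ne_zero ha
  have hsC : Complex.sin (π * a) ≠ 0 := by exact_mod_cast hs
  set t := tanh (π * b) * (cos (π * a) / sin (π * a)) with ht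
  set W : ℂ := Complex.sin (π * (a + b * Complex.I)) / Complex.sin (π * a) with hW
  have hlim : Tendsto (fun N => eulerSinPartial N (a + b * Complex.I) / eulerSinPartial N a) atTop
      (nhds W) :=
    (Complex.tendsto_euler_sin_prod _).div (Complex.tendsto_euler_sin_prod _) hsC
  have hsum : Tendsto (fun N => arctan (b / a) + ∑ n ∈ Finset.range N, arctanPair a b n) atTop
      (nhds (arctanSeries a b)) :=
    (summable_arctanPair ha b).hasSum.tendsto_sum_nat.const_add _
  have hexp : Continuous fun s : ℝ => Complex.exp (s * Complex.I) := by fun_prop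
  have hnorm : Tendsto (fun N =>
      ((‖eulerSinPartial N (a + b * Complex.I) / eulerSinPartial N a‖ : ℝ) : ℂ)) atTop
      (nhds ((‖W‖ : ℝ) : ℂ)) :=
    (Complex.continuous_ofReal.tendsto _).comp hlim.norm
  have hWS : W = ‖W‖ * Complex.exp (arctanSeries a b * Complex.I) := by
    refine tendsto_nhds_unique hlim ?_
    refine (hnorm.mul ((hexp.tendsto _).comp hsum)).congr fun N => ?_
    exact (eulerSinPartial_ratio ha b N).symm
  have hch : 0 < cosh (π * b) := cosh_pos _
  have hWt : W = cosh (π * b) * (1 + t * Complex.I) := by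
    have hchC : Complex.cosh (π * b) ≠ 0 := by exact_mod_cast hch.ne'
    rw [hW, ht, mul_add, ← mul_assoc, Complex.sin_add_mul_I, tanh_eq_sinh_div_cosh]
    push_cast
    field_simp
  have hnW : ‖W‖ = cosh (π * b) * ‖(1 + t * Complex.I : ℂ)‖ := by
    rw [hWt, norm_mul, Complex.norm_real, Real.norm_eq_abs, abs_of_pos hch]
  have hWT : W = ‖W‖ * Complex.exp (arctan t * Complex.I) := by
    rw [hnW]
    conv_lhs => rw [hWt, one_add_mul_I_eq_norm_mul_exp t]
    push_cast
    ring
  have hn0 : ((‖W‖ : ℝ) : ℂ) ≠ 0 := by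
    have h1 : (1 + t * Complex.I : ℂ) ≠ 0 := fun h => by simpa using congrArg Complex.re h
    rw [hnW]
    exact_mod_cast (mul_pos hch (norm_pos_iff.2 h1)).ne'
  have he := mul_left_cancel₀ hn0 (hWS.symm.trans hWT)
  have h1 : Complex.exp ((arctanSeries a b - arctan t : ℝ) * Complex.I) = 1 := by
    rw [Complex.ofReal_sub, sub_mul, Complex.exp_sub, he, div_self (Complex.exp_ne_zero _)]
  rw [← Complex.exp_ofReal_mul_I_re, h1, Complex.one_re]

theorem eq_zero_of_continuous_of_cos_eq_one {h : ℝ → ℝ} (hc : Continuous h) (h0 : h 0 = 0)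
    (hcos : ∀ b, cos (h b) = 1) (b : ℝ) : h b = 0 := by
  have key : ∀ c, |h c| ≠ π := fun c hcπ => by
    have := hcos c
    rw [← cos_abs, hcπ, cos_pi] at this
    norm_num at this
  have hlt : |h b| < π := by
    by_contra! hge
    obtain ⟨c, hcπ⟩ := mem_range_of_exists_le_of_exists_ge hc.abs
      ⟨0, by simpa [h0] using pi_pos.le⟩ ⟨b, hge⟩
    exact key c hcπ
  rw [abs_lt] at hlt
  exact (cos_eq_one_iff_of_lt_of_lt (by linarith [pi_pos]) (by linarith [pi_pos])).1 (hcos b)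

theorem arctanSeries_eq {a : ℝ} (ha : ∀ n : ℤ, a - n ≠ 0) (b : ℝ) :
    arctanSeries a b = arctan (tanh (π * b) * (cos (π * a) / sin (π * a))) := by
  have htanh : Continuous tanh := by
    have : tanh = fun x => sinh x / cosh x := funext tanh_eq_sinh_div_cosh
    rw [this]
    exact continuous_sinh.div continuous_cosh fun x => (cosh_pos x).ne'
  have hS := continuous_arctanSeries ha
  refine sub_eq_zero.1 (eq_zero_of_continuous_of_cos_eq_one
    (h := fun b => arctanSeries a b - arctan (tanh (π * b) * (cos (π * a) / sin (π * a))))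
    (by fun_prop) ?_ (cos_arctanSeries_sub_eq_one ha) b)
  simp [arctanSeries, arctanPair]

/-- Infinite decomposition of Scherk's maximal surfaces into dilated helicoids. -/
theorem scherk_maximal_infinite_decomposition (θ : ℝ) (hθ0 : 0 < θ) (hθ1 : θ < Real.pi / 2)
    (x y : ℝ) (hx : Real.cos (x * Real.sin θ / 2) ≠ 0) (hy : y ≠ 0)
    (hpos : Real.tan (x * Real.sin θ / 2) / Real.tanh (y * Real.sin (θ / 2)) > 0) :
    (∀ n : ℤ, x * Real.cos (θ / 2) - n * (Real.pi / Real.sin (θ / 2)) ≠ 0) ∧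
    ∃ S : ℝ,
      Filter.Tendsto
        (fun N : ℕ => ∑ n ∈ Finset.Icc (-(N : ℤ)) (N : ℤ),
          Real.arctan (y / (x * Real.cos (θ / 2) - n * (Real.pi / Real.sin (θ / 2)))))
        Filter.atTop (nhds S) ∧
      psi x y θ = (Real.cos (θ / 2))⁻¹ * (Real.pi / 2 - S) := by
  have hs : 0 < sin (θ / 2) := sin_pos_of_pos_of_lt_pi (by linarith) (by linarith [pi_pos])
  set s := sin (θ / 2) with hs_def
  have hA : x * sin θ / 2 = π * (x * cos (θ / 2) * s / π) := by
    have : sin θ = 2 * s * cos (θ / 2) := by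
      rw [hs_def, ← sin_two_mul]
      congr 1
      ring
    rw [this]
    field_simp
  have hB : y * s = π * (y * s / π) := by field_simp
  set a := x * cos (θ / 2) * s / π with ha_def
  set b := y * s / π with hb_def
  rw [hA] at hpos
  have hden : ∀ n : ℤ, x * cos (θ / 2) - n * (π / s) = (a - n) * (π / s) := fun n => by
    rw [ha_def]
    field_simp
  have hsin : sin (π * a) ≠ 0 := fun h => by
    rw [tan_eq_sin_div_cos, h] at hpos
    simp at hpos
  have ha : ∀ n : ℤ, a - n ≠ 0 := fun n hn => hsin <| by
    rw [sub_eq_zero.1 hn, mul_comm]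
    exact sin_int_mul_pi n
  refine ⟨fun n => ?_, arctanSeries a b, ?_, ?_⟩
  · rw [hden]
    exact mul_ne_zero (ha n) (by positivity)
  · refine (tendsto_sum_Icc_arctan ha b).congr fun N => Finset.sum_congr rfl fun n _ => ?_
    have := ha n
    rw [hden, hb_def]
    congr 1
    field_simp
  · rw [psi, ← hs_def, hA, hB, arctanSeries_eq ha, ← hB, hB]
    rw [hB] at hpos
    rw [show tanh (π * b) * (cos (π * a) / sin (π * a)) = (tan (π * a) / tanh (π * b))⁻¹ by
      rw [tan_eq_sin_div_cos, inv_div, div_div_eq_mul_div, mul_div_assoc], arctan_inv_of_pos hpos]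
    ring
end

section
/- Let θ ∈ (0, π/2) and let y, z ∈ ℝ with y ≠ 0 and |tanh(z·(sin θ)/2)| < |tanh(y·sin(θ/2))|. Then for every integer n the complex number z·cos(θ/2) / (y − i·nπ/sin(θ/2)) lies outside the set (−∞, −1] ∪ [1, ∞) of real numbers (so its complex inverse hyperbolic tangent is defined), the bilateral sum below converges as the limit of symmetric partial sums, and, as an equality of complex numbers, χ(y, z; θ) = sec(θ/2)·Σ_{n=−∞}^{∞} artanh_ℂ( z·cos(θ/2) / (y − i·nπ/sin(θ/2)) ). -/
open Real Filter Complex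

/-- Real inverse hyperbolic tangent. -/
noncomputable def artanhR (x : ℝ) : ℝ := (1 / 2) * Real.log ((1 + x) / (1 - x))

/-- Height function of Scherk's type Born–Infeld solitons. -/
noncomputable def chi (y z θ : ℝ) : ℝ :=
  (Real.cos (θ / 2))⁻¹ *
    artanhR (Real.tanh (z * Real.sin θ / 2) / Real.tanh (y * Real.sin (θ / 2)))

/-- The slit `(-∞, -1] ∪ [1, ∞)` of real numbers inside `ℂ`. -/
def artanhSlit : Set ℂ := {w : ℂ | w.im = 0 ∧ (w.re ≤ -1 ∨ 1 ≤ w.re)}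

/-- Principal branch of the complex inverse hyperbolic tangent. -/
noncomputable def artanhC (w : ℂ) : ℂ := (1 / 2) * Complex.log ((1 + w) / (1 - w))

open Topology

/-- Partial products of Euler's product formula for `sinh`. -/
noncomputable def sinhPartialProd (x : ℝ) (N : ℕ) : ℝ :=
  x * ∏ j ∈ Finset.range N, (1 + x ^ 2 / (((j : ℝ) + 1) * Real.pi) ^ 2)

theorem tendsto_sinhPartialProd (x : ℝ) :
    Tendsto (sinhPartialProd x) atTop (𝓝 (Real.sinh x)) := by
  have hpi : (Real.pi : ℂ) ≠ 0 := by exact_mod_cast Real.pi_ne_zero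
  have h := (Complex.tendsto_euler_sin_prod ((x : ℂ) * I / Real.pi)).const_mul (-I)
  have hlim : -I * Complex.sin (Real.pi * ((x : ℂ) * I / Real.pi)) = (Real.sinh x : ℝ) := by
    rw [mul_div_cancel₀ _ hpi, Complex.sin_mul_I]
    push_cast
    linear_combination -Complex.sinh x * I_mul_I
  rw [hlim] at h
  have hre := (Complex.continuous_re.tendsto _).comp h
  rw [ofReal_re] at hre
  refine hre.congr fun N => ?_
  have hterm : -I * (Real.pi * ((x : ℂ) * I / Real.pi) *
      ∏ j ∈ Finset.range N, (1 - ((x : ℂ) * I / Real.pi) ^ 2 / ((j : ℂ) + 1) ^ 2)) =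
      (sinhPartialProd x N : ℝ) := by
    have hprod : ∏ j ∈ Finset.range N, (1 - ((x : ℂ) * I / Real.pi) ^ 2 / ((j : ℂ) + 1) ^ 2) =
        ∏ j ∈ Finset.range N, (1 + (x : ℂ) ^ 2 / (((j : ℂ) + 1) * Real.pi) ^ 2) := by
      refine Finset.prod_congr rfl fun j _ => ?_
      rw [div_pow, mul_pow, I_sq, div_div, mul_pow]
      ring
    rw [hprod, mul_div_cancel₀ _ hpi, sinhPartialProd]
    push_cast
    linear_combination (-(x : ℂ) *
      ∏ j ∈ Finset.range N, (1 + (x : ℂ) ^ 2 / (((j : ℂ) + 1) * Real.pi) ^ 2)) * I_mul_I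
  simp only [Function.comp_apply]
  rw [hterm, ofReal_re]

theorem sinhPartialProd_succ (x : ℝ) (N : ℕ) :
    sinhPartialProd x (N + 1) =
      sinhPartialProd x N * (1 + x ^ 2 / (((N : ℝ) + 1) * Real.pi) ^ 2) := by
  simp only [sinhPartialProd, Finset.prod_range_succ, mul_assoc]

theorem sinhPartialProd_div_pos {p q : ℝ} (h : 0 < p * q) (N : ℕ) :
    0 < sinhPartialProd p N / sinhPartialProd q N := by
  have hq : q ≠ 0 := right_ne_zero_of_mul h.ne'
  have hpq : 0 < p / q := by
    rw [show p / q = p * q / q ^ 2 by field_simp]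
    positivity
  rw [sinhPartialProd, sinhPartialProd, mul_div_mul_comm]
  exact mul_pos hpq (div_pos (Finset.prod_pos fun _ _ => by positivity)
    (Finset.prod_pos fun _ _ => by positivity))

theorem Real.sinh_mul_sinh_pos_iff {p q : ℝ} :
    0 < Real.sinh p * Real.sinh q ↔ 0 < p * q := by
  simp only [mul_pos_iff, Real.sinh_pos_iff, Real.sinh_neg_iff]

theorem Complex.log_add_log_conj {u : ℂ} (hu : u ∈ slitPlane) :
    Complex.log u + Complex.log (starRingEnd ℂ u) = (Real.log (normSq u) : ℝ) := by
  rw [Complex.log_conj _ (slitPlane_arg_ne_pi hu), Complex.add_conj, Complex.log_re,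
    Complex.normSq_eq_norm_sq, Real.log_pow]
  push_cast
  ring

theorem sub_I_mul_ne_zero {a : ℝ} (ha : a ≠ 0) (m : ℝ) : (a : ℂ) - I * m ≠ 0 := fun h =>
  ha (by simpa using congrArg Complex.re h)

theorem div_sub_I_mul_notMem_artanhSlit {a b : ℝ} (h : 0 < (a + b) * (a - b)) (m : ℝ) :
    (b : ℂ) / ((a : ℂ) - I * m) ∉ artanhSlit := by
  have hD : 0 < a * a + m * m := by nlinarith [mul_self_nonneg b, mul_self_nonneg m]
  have hre : ((b : ℂ) / ((a : ℂ) - I * m)).re = b * a / (a * a + m * m) := by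
    simp [Complex.div_re, Complex.normSq_apply]
  rintro ⟨-, hle | hge⟩
  · rw [hre, div_le_iff₀ hD] at hle
    nlinarith [sq_nonneg (a + b), mul_self_nonneg m]
  · rw [hre, le_div_iff₀ hD] at hge
    nlinarith [sq_nonneg (a - b), mul_self_nonneg m]

theorem one_add_div_one_sub_div_sub_I_mul {a : ℝ} (ha : a ≠ 0) (b m : ℝ) :
    (1 + (b : ℂ) / ((a : ℂ) - I * m)) / (1 - (b : ℂ) / ((a : ℂ) - I * m)) =
      (((a + b : ℝ) : ℂ) - I * m) / (((a - b : ℝ) : ℂ) - I * m) := by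
  have h := sub_I_mul_ne_zero ha m
  rw [one_add_div h, one_sub_div h, div_div_div_cancel_right₀ h]
  push_cast
  ring_nf

theorem normSq_sub_I_mul (p m : ℝ) : normSq ((p : ℂ) - I * m) = p ^ 2 + m ^ 2 := by
  simp [Complex.normSq_apply, sq]

theorem div_sub_I_mul_mem_slitPlane {p q : ℝ} (h : 0 < p * q) (m : ℝ) :
    ((p : ℂ) - I * m) / ((q : ℂ) - I * m) ∈ slitPlane := by
  have hq : q ≠ 0 := right_ne_zero_of_mul h.ne'
  refine Or.inl ?_
  rw [Complex.div_re, normSq_sub_I_mul, ← add_div]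
  refine div_pos ?_ (by positivity)
  simp
  nlinarith [mul_self_nonneg m]

theorem artanhC_add_artanhC_neg {a b : ℝ} (h : 0 < (a + b) * (a - b)) (m : ℝ) :
    artanhC ((b : ℂ) / ((a : ℂ) - I * m)) + artanhC ((b : ℂ) / ((a : ℂ) - I * (-m : ℝ))) =
      ((1 / 2 * Real.log (((a + b) ^ 2 + m ^ 2) / ((a - b) ^ 2 + m ^ 2)) : ℝ) : ℂ) := by
  have ha : a ≠ 0 := by
    rintro rfl
    nlinarith [mul_self_nonneg b]
  have hlog := Complex.log_add_log_conj (div_sub_I_mul_mem_slitPlane h m)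
  have hconj : starRingEnd ℂ ((((a + b : ℝ) : ℂ) - I * m) / (((a - b : ℝ) : ℂ) - I * m)) =
      (((a + b : ℝ) : ℂ) - I * (-m : ℝ)) / (((a - b : ℝ) : ℂ) - I * (-m : ℝ)) := by
    simp only [map_div₀, map_sub, map_mul, conj_ofReal, conj_I, ofReal_neg, neg_mul, mul_neg]
  rw [hconj, map_div₀, normSq_sub_I_mul, normSq_sub_I_mul] at hlog
  rw [artanhC, artanhC, one_add_div_one_sub_div_sub_I_mul ha,
    one_add_div_one_sub_div_sub_I_mul ha, ← mul_add, hlog]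
  push_cast
  ring

theorem sum_Icc_neg_succ {M : Type*} [AddCommMonoid M] (f : ℤ → M) (N : ℕ) :
    ∑ n ∈ Finset.Icc (-((N + 1 : ℕ) : ℤ)) ((N + 1 : ℕ) : ℤ), f n =
      ∑ n ∈ Finset.Icc (-(N : ℤ)) (N : ℤ), f n + (f (N + 1) + f (-(N + 1))) := by
  have hset : Finset.Icc (-((N + 1 : ℕ) : ℤ)) ((N + 1 : ℕ) : ℤ) =
      insert ((N : ℤ) + 1) (insert (-((N : ℤ) + 1)) (Finset.Icc (-(N : ℤ)) (N : ℤ))) := by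
    ext k
    simp only [Finset.mem_Icc, Finset.mem_insert]
    omega
  rw [hset, Finset.sum_insert (by simp only [Finset.mem_insert, Finset.mem_Icc]; omega),
    Finset.sum_insert (by simp only [Finset.mem_Icc]; omega), ← add_assoc, add_comm]

theorem sum_artanhC_eq {a b : ℝ} (h : 0 < (a + b) * (a - b)) (N : ℕ) :
    ∑ n ∈ Finset.Icc (-(N : ℤ)) (N : ℤ),
        artanhC ((b : ℂ) / ((a : ℂ) - I * (n * Real.pi : ℝ))) =
      ((1 / 2 * Real.log (sinhPartialProd (a + b) N / sinhPartialProd (a - b) N) : ℝ) : ℂ) := by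
  have ha : a ≠ 0 := by
    rintro rfl
    nlinarith [mul_self_nonneg b]
  induction N with
  | zero =>
    have hpos := sinhPartialProd_div_pos h 0
    simp only [sinhPartialProd, Finset.range_zero, Finset.prod_empty, mul_one] at hpos ⊢
    have h0 := one_add_div_one_sub_div_sub_I_mul ha b 0
    simp only [ofReal_zero, mul_zero, sub_zero] at h0
    simp only [Nat.cast_zero, neg_zero, Finset.Icc_self, Finset.sum_singleton, Int.cast_zero,
      zero_mul, ofReal_zero, mul_zero, sub_zero]
    rw [artanhC, h0, ofReal_mul, ofReal_log hpos.le]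
    push_cast
    rfl
  | succ N ih =>
    have hm : 0 < (((N : ℝ) + 1) * Real.pi) ^ 2 := by positivity
    have hterm := artanhC_add_artanhC_neg h (((N : ℝ) + 1) * Real.pi)
    have hfactor : ((a + b) ^ 2 + (((N : ℝ) + 1) * Real.pi) ^ 2) /
          ((a - b) ^ 2 + (((N : ℝ) + 1) * Real.pi) ^ 2) =
        (1 + (a + b) ^ 2 / (((N : ℝ) + 1) * Real.pi) ^ 2) /
          (1 + (a - b) ^ 2 / (((N : ℝ) + 1) * Real.pi) ^ 2) := by
      rw [one_add_div hm.ne', one_add_div hm.ne', div_div_div_cancel_right₀ hm.ne',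
        add_comm ((a + b) ^ 2), add_comm ((a - b) ^ 2)]
    rw [hfactor] at hterm
    rw [sum_Icc_neg_succ, ih, sinhPartialProd_succ, sinhPartialProd_succ, mul_div_mul_comm,
      Real.log_mul (sinhPartialProd_div_pos h N).ne' (by positivity), mul_add, ofReal_add,
      ← hterm]
    push_cast
    ring_nf

theorem artanhR_tanh_div_tanh {a b : ℝ} (ha : a ≠ 0) :
    artanhR (Real.tanh b / Real.tanh a) =
      1 / 2 * Real.log (Real.sinh (a + b) / Real.sinh (a - b)) := by
  have hsa : Real.sinh a ≠ 0 := by rwa [Ne, Real.sinh_eq_zero]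
  have hca := (Real.cosh_pos a).ne'
  have hcb := (Real.cosh_pos b).ne'
  have hd : Real.tanh b / Real.tanh a =
      (Real.cosh a * Real.sinh b) / (Real.sinh a * Real.cosh b) := by
    rw [Real.tanh_eq_sinh_div_cosh, Real.tanh_eq_sinh_div_cosh]
    field_simp
  have hab : Real.sinh a * Real.cosh b ≠ 0 := mul_ne_zero hsa hcb
  rw [artanhR, hd, one_add_div hab, one_sub_div hab, div_div_div_cancel_right₀ hab,
    Real.sinh_add, Real.sinh_sub]

theorem add_mul_sub_pos_of_abs_tanh_lt {a b : ℝ} (h : |Real.tanh b| < |Real.tanh a|) :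
    0 < (a + b) * (a - b) := by
  rw [← Real.sinh_mul_sinh_pos_iff, Real.sinh_add, Real.sinh_sub]
  have hca := Real.cosh_pos a
  have hcb := Real.cosh_pos b
  rw [Real.tanh_eq_sinh_div_cosh, Real.tanh_eq_sinh_div_cosh, abs_div, abs_div, abs_of_pos hca,
    abs_of_pos hcb, div_lt_div_iff₀ hcb hca] at h
  have hsq := mul_self_lt_mul_self (by positivity) h
  have ea := abs_mul_abs_self (Real.sinh a)
  have eb := abs_mul_abs_self (Real.sinh b)
  calc (0 : ℝ) < _ := sub_pos.2 hsq
    _ = _ := by linear_combination Real.cosh b ^ 2 * ea - Real.cosh a ^ 2 * eb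

/-- Infinite decomposition of Scherk's type Born–Infeld solitons into dilated
hyperbolic helicoids, as an equality of complex numbers. -/
theorem scherk_born_infeld_infinite_decomposition (θ : ℝ) (hθ0 : 0 < θ)
    (hθ1 : θ < Real.pi / 2) (y z : ℝ) (hy : y ≠ 0)
    (hlt : |Real.tanh (z * Real.sin θ / 2)| < |Real.tanh (y * Real.sin (θ / 2))|) :
    (∀ n : ℤ,
      ((z * Real.cos (θ / 2) : ℝ) : ℂ) /
        ((y : ℂ) - Complex.I * n * Real.pi / (Real.sin (θ / 2) : ℂ)) ∉ artanhSlit) ∧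
    ∃ S : ℂ,
      Filter.Tendsto
        (fun N : ℕ => ∑ n ∈ Finset.Icc (-(N : ℤ)) (N : ℤ),
          artanhC (((z * Real.cos (θ / 2) : ℝ) : ℂ) /
            ((y : ℂ) - Complex.I * n * Real.pi / (Real.sin (θ / 2) : ℂ))))
        Filter.atTop (nhds S) ∧
      ((chi y z θ : ℝ) : ℂ) = ((Real.cos (θ / 2) : ℝ) : ℂ)⁻¹ * S := by
  have hs : 0 < Real.sin (θ / 2) := Real.sin_pos_of_pos_of_lt_pi (by linarith) (by linarith)
  have hzs : z * Real.sin θ / 2 = z * Real.cos (θ / 2) * Real.sin (θ / 2) := by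
    have h2 := Real.sin_two_mul (θ / 2)
    rw [mul_div_cancel₀ _ (two_ne_zero' ℝ)] at h2
    rw [h2]
    ring
  rw [hzs] at hlt
  have hpos := add_mul_sub_pos_of_abs_tanh_lt hlt
  have hscale (n : ℤ) : ((z * Real.cos (θ / 2) : ℝ) : ℂ) /
        ((y : ℂ) - Complex.I * n * Real.pi / (Real.sin (θ / 2) : ℂ)) =
      ((z * Real.cos (θ / 2) * Real.sin (θ / 2) : ℝ) : ℂ) /
        (((y * Real.sin (θ / 2) : ℝ) : ℂ) - I * (n * Real.pi : ℝ)) := by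
    have hsC : (Real.sin (θ / 2) : ℂ) ≠ 0 := by exact_mod_cast hs.ne'
    rw [ofReal_mul (z * Real.cos (θ / 2)), ← mul_div_mul_right _ _ hsC, sub_mul,
      div_mul_cancel₀ _ hsC, ofReal_mul y, ofReal_mul (n : ℝ), ofReal_intCast, mul_assoc I]
  simp only [hscale]
  refine ⟨fun n => div_sub_I_mul_notMem_artanhSlit hpos _,
    (artanhR (Real.tanh (z * Real.sin θ / 2) / Real.tanh (y * Real.sin (θ / 2))) : ℝ), ?_, ?_⟩
  · simp only [sum_artanhC_eq hpos]
    rw [hzs, artanhR_tanh_div_tanh (mul_ne_zero hy hs.ne')]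
    have hsinh := Real.sinh_mul_sinh_pos_iff.2 hpos
    refine (Complex.continuous_ofReal.tendsto _).comp (Tendsto.const_mul _ (Tendsto.log ?_ ?_))
    · exact (tendsto_sinhPartialProd _).div (tendsto_sinhPartialProd _)
        (right_ne_zero_of_mul hsinh.ne')
    · exact div_ne_zero (left_ne_zero_of_mul hsinh.ne') (right_ne_zero_of_mul hsinh.ne')
  · rw [chi, ofReal_mul, ofReal_inv]
end

section
/- Let n be a positive integer and β ∈ (0, π/8). Let x, y ∈ ℝ satisfy: y ≠ 0; 2x·sin β is not an odd multiple of π/2 and tan(2x·sin β) / tanh(y·sin 2β) > 0; and for every m ∈ {0, …, n−1}, (2x·sin β + mπ)/n is not an integer multiple of π/2 (so that tan of it is defined and nonzero). Then ψ(sec β · sec 2β · x, y; 4β) = (π/2)·sec 2β + (cos β / cos 2β)·Σ_{m=0}^{n−1} φ( 2y/n, 2x/n + mπ/(n·sin β) ; 2β ). -/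
open Real

/-- Height function of the one-parameter family of Scherk's minimal surfaces. -/
noncomputable def phi (x y θ : ℝ) : ℝ :=
  -(Real.cos (θ / 2))⁻¹ *
    Real.arctan (Real.tanh (x * Real.sin θ / 2) / Real.tan (y * Real.sin (θ / 2)))

open Polynomial in
theorem IsPrimitiveRoot.prod_sub_pow_mul {R : Type*} [CommRing R] [IsDomain R] {n : ℕ} {ζ : R}
    (hζ : IsPrimitiveRoot ζ n) (hn : 0 < n) (a b : R) :
    ∏ m ∈ Finset.range n, (a - ζ ^ m * b) = a ^ n - b ^ n := by
  simpa [eval_prod] using (congrArg (eval a) (X_pow_sub_C_eq_prod hζ hn (α := b) rfl)).symm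

theorem Complex.exp_two_mul_arctan_mul (s : ℝ) :
    Complex.exp (2 * (Real.arctan s : ℂ) * Complex.I) * (1 - s * Complex.I) =
      1 + s * Complex.I := by
  have hc : (Real.cos (Real.arctan s) : ℂ) ≠ 0 :=
    Complex.ofReal_ne_zero.2 (Real.cos_arctan_pos s).ne'
  have hs : (Real.sin (Real.arctan s) : ℂ) = s * Real.cos (Real.arctan s) := by
    rw [← Complex.ofReal_mul, Real.sin_arctan, Real.cos_arctan]
    congr 1
    ring
  have h1 := Complex.exp_mul_I (Real.arctan s : ℂ)
  have h2 := Complex.exp_mul_I (-(Real.arctan s : ℂ))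
  rw [Complex.cos_neg, Complex.sin_neg] at h2
  rw [← Complex.ofReal_cos, ← Complex.ofReal_sin, hs] at h1 h2
  have h3 : Complex.exp (2 * (Real.arctan s : ℂ) * Complex.I) *
      Complex.exp (-(Real.arctan s : ℂ) * Complex.I) =
        Complex.exp ((Real.arctan s : ℂ) * Complex.I) := by
    rw [← Complex.exp_add]
    ring_nf
  rw [h1, h2] at h3
  apply mul_left_cancel₀ hc
  linear_combination h3

theorem Complex.exp_two_mul_arctan_tanh_div_tan_mul {p : ℝ} (hp : Real.sin p ≠ 0) (q : ℝ) :
    Complex.exp (2 * (Real.arctan (Real.tanh q / Real.tan p) : ℂ) * Complex.I) *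
        (Complex.exp (2 * q) * Complex.exp (2 * p * Complex.I) - 1) =
      Complex.exp (2 * p * Complex.I) - Complex.exp (2 * q) := by
  have hw := Complex.exp_two_mul_arctan_mul (Real.tanh q / Real.tan p)
  set w := Complex.exp (2 * (Real.arctan (Real.tanh q / Real.tan p) : ℂ) * Complex.I)
  rw [Real.tan_eq_sin_div_cos, Real.tanh_eq_sinh_div_cosh, div_div_eq_mul_div] at hw
  have hC : (Real.cosh q : ℂ) ≠ 0 := Complex.ofReal_ne_zero.2 (Real.cosh_pos q).ne'
  have hs : (Real.sin p : ℂ) ≠ 0 := Complex.ofReal_ne_zero.2 hp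
  push_cast at hw hC hs
  field_simp at hw
  have hE : Complex.exp (2 * p * Complex.I) =
      (Complex.cos p + Complex.sin p * Complex.I) ^ 2 := by
    rw [← Complex.exp_mul_I, ← Complex.exp_nat_mul]
    push_cast
    ring_nf
  have hQ : Complex.exp (2 * q) = (Complex.cosh q + Complex.sinh q) ^ 2 := by
    rw [Complex.cosh_add_sinh, ← Complex.exp_nat_mul]
    push_cast
    ring_nf
  have h1 := Complex.cos_sq_add_sin_sq (p : ℂ)
  have h2 := Complex.cosh_sq_sub_sinh_sq (q : ℂ)
  have hI := Complex.I_sq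
  rw [hE, hQ]
  generalize Complex.cos p = c at *
  generalize Complex.sin p = s at *
  generalize Complex.cosh q = C at *
  generalize Complex.sinh q = S at *
  have e1 : (C + S) ^ 2 * (c + s * Complex.I) ^ 2 - 1 =
      (C + S) * (c + s * Complex.I) * (2 * Complex.I * (C * s - S * c * Complex.I)) := by
    linear_combination (C ^ 2 - S ^ 2) * h1 + h2 +
      ((C + S) * (c + s * Complex.I) * (2 * S * c) - (C ^ 2 - S ^ 2) * s ^ 2) * hI
  have e2 : (c + s * Complex.I) ^ 2 - (C + S) ^ 2 =
      (C + S) * (c + s * Complex.I) * (2 * Complex.I * (C * s + S * c * Complex.I)) := by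
    linear_combination -(c + s * Complex.I) ^ 2 * h2 + (C + S) ^ 2 * h1 -
      ((C + S) ^ 2 * s ^ 2 + (C + S) * (c + s * Complex.I) * (2 * S * c)) * hI
  rw [e1, e2]
  linear_combination (C + S) * (c + s * Complex.I) * (2 * Complex.I) * hw

theorem Complex.exp_two_mul_sum_arctan_tanh_div_tan {n : ℕ} (hn : 0 < n) {A : ℝ}
    (hA : Real.sin A ≠ 0) (t : ℝ) :
    Complex.exp (2 * ((∑ m ∈ Finset.range n,
        Real.arctan (Real.tanh (t / n) / Real.tan ((A + m * Real.pi) / n)) : ℝ) : ℂ) *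
          Complex.I) =
      Complex.exp (2 * (Real.arctan (Real.tanh t / Real.tan A) : ℂ) * Complex.I) := by
  have hn' : (n : ℝ) ≠ 0 := by positivity
  have hnC : (n : ℂ) ≠ 0 := by exact_mod_cast hn.ne'
  have hsin (m : ℕ) : Real.sin ((A + m * Real.pi) / n) ≠ 0 := by
    intro h
    obtain ⟨k, hk⟩ := Real.sin_eq_zero_iff.1 h
    refine hA (Real.sin_eq_zero_iff.2 ⟨k * n - m, ?_⟩)
    field_simp at hk
    push_cast
    linarith
  have hζ := Complex.isPrimitiveRoot_exp n hn.ne'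
  set ζ := Complex.exp (2 * Real.pi * Complex.I / n)
  set E := Complex.exp (2 * (A / n : ℝ) * Complex.I) with hE
  set Q := Complex.exp (2 * (t / n : ℝ)) with hQ
  have hEn : E ^ n = Complex.exp (2 * A * Complex.I) := by
    rw [hE, ← Complex.exp_nat_mul]
    congr 1
    push_cast
    field_simp
  have hQn : Q ^ n = Complex.exp (2 * t) := by
    rw [hQ, ← Complex.exp_nat_mul]
    congr 1
    push_cast
    field_simp
  have hEm (m : ℕ) :
      Complex.exp (2 * ((A + m * Real.pi) / n : ℝ) * Complex.I) = ζ ^ m * E := by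
    rw [hE, ← Complex.exp_nat_mul, ← Complex.exp_add]
    congr 1
    push_cast
    ring
  have hne : Complex.exp (2 * t) * Complex.exp (2 * A * Complex.I) - 1 ≠ 0 := by
    rw [← Complex.exp_add, sub_ne_zero, Ne, Complex.exp_eq_one_iff]
    rintro ⟨k, hk⟩
    refine hA (Real.sin_eq_zero_iff.2 ⟨k, ?_⟩)
    have := congrArg Complex.im hk
    simp at this
    linarith
  apply mul_right_cancel₀ hne
  rw [Complex.exp_two_mul_arctan_tanh_div_tan_mul hA, Complex.ofReal_sum, Finset.mul_sum,
    Finset.sum_mul, Complex.exp_sum]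
  have hprod := Finset.prod_congr rfl fun m (_ : m ∈ Finset.range n) ↦
    Complex.exp_two_mul_arctan_tanh_div_tan_mul (hsin m) (t / n)
  rw [Finset.prod_mul_distrib] at hprod
  simp only [hEm, ← hQ] at hprod
  have hneg (f : ℕ → ℂ) : ∏ m ∈ Finset.range n, -f m = (-1) ^ n * ∏ m ∈ Finset.range n, f m := by
    simp_rw [← neg_one_mul (f _), Finset.prod_mul_distrib, Finset.prod_const, Finset.card_range]
  have h1 : ∏ m ∈ Finset.range n, (Q * (ζ ^ m * E) - 1) = (-1) ^ n * (1 - (Q * E) ^ n) := by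
    rw [← one_pow n, ← hζ.prod_sub_pow_mul hn 1 (Q * E), one_pow, ← hneg]
    exact Finset.prod_congr rfl fun m _ ↦ by ring
  have h2 : ∏ m ∈ Finset.range n, (ζ ^ m * E - Q) = (-1) ^ n * (Q ^ n - E ^ n) := by
    rw [← hζ.prod_sub_pow_mul hn, ← hneg]
    exact Finset.prod_congr rfl fun m _ ↦ by ring
  rw [h1, h2, mul_pow, hEn, hQn, mul_left_comm] at hprod
  linear_combination -mul_left_cancel₀ (pow_ne_zero n (neg_ne_zero.2 one_ne_zero)) hprod

theorem Real.continuous_tanh : Continuous Real.tanh := by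
  simp_rw [funext Real.tanh_eq_sinh_div_cosh]
  exact Real.continuous_sinh.div Real.continuous_cosh fun x ↦ (Real.cosh_pos x).ne'

theorem Real.arctan_tanh_div_tan_eq_sum {n : ℕ} (hn : 0 < n) {A : ℝ}
    (hA : Real.sin A ≠ 0) (t : ℝ) :
    Real.arctan (Real.tanh t / Real.tan A) = ∑ m ∈ Finset.range n,
      Real.arctan (Real.tanh (t / n) / Real.tan ((A + m * Real.pi) / n)) := by
  let g : ℝ → ℝ := fun t ↦ ∑ m ∈ Finset.range n,
      Real.arctan (Real.tanh (t / n) / Real.tan ((A + m * Real.pi) / n)) -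
    Real.arctan (Real.tanh t / Real.tan A)
  have hg : Continuous g := by
    have := Real.continuous_tanh
    have := Real.continuous_arctan
    fun_prop
  have hmem : Set.range g ⊆ Set.range fun k : ℤ ↦ k * Real.pi := by
    rintro _ ⟨s, rfl⟩
    obtain ⟨k, hk⟩ := Complex.exp_eq_exp_iff_exists_int.1
      (Complex.exp_two_mul_sum_arctan_tanh_div_tan hn hA s)
    refine ⟨k, ?_⟩
    have := congrArg Complex.im hk
    simp [-Complex.ofReal_sum, -Complex.ofReal_arctan] at this
    simp only [g]
    linarith
  have h0 : g t = g 0 := (Set.countable_range _).isTotallyDisconnected _ hmem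
    (isPreconnected_range hg) ⟨t, rfl⟩ ⟨0, rfl⟩
  simp only [g, zero_div, Real.tanh_zero, Real.arctan_zero, Finset.sum_const_zero, sub_zero] at h0
  linarith

/-- Finite decomposition of Scherk's maximal surfaces into dilated Scherk's
minimal surfaces. -/
theorem psi_finite_decomposition_into_phi (n : ℕ) (hn : 0 < n)
    (β : ℝ) (hβ0 : 0 < β) (hβ1 : β < Real.pi / 8)
    (x y : ℝ) (hy : y ≠ 0)
    (hx1 : ∀ k : ℤ, 2 * x * Real.sin β ≠ (2 * k + 1) * (Real.pi / 2))
    (hx2 : 0 < Real.tan (2 * x * Real.sin β) / Real.tanh (y * Real.sin (2 * β)))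
    (hm : ∀ m : ℕ, m < n →
      ∀ k : ℤ, (2 * x * Real.sin β + m * Real.pi) / n ≠ k * (Real.pi / 2)) :
    psi ((Real.cos β)⁻¹ * (Real.cos (2 * β))⁻¹ * x) y (4 * β) =
      (Real.pi / 2) * (Real.cos (2 * β))⁻¹ +
      (Real.cos β / Real.cos (2 * β)) *
        ∑ m ∈ Finset.range n,
          phi (2 * y / n) (2 * x / n + m * Real.pi / (n * Real.sin β)) (2 * β) := by
  have hsin : Real.sin β ≠ 0 := (Real.sin_pos_of_pos_of_lt_pi hβ0 (by linarith [Real.pi_pos])).ne'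
  have hcos : Real.cos β ≠ 0 :=
    (Real.cos_pos_of_mem_Ioo ⟨by linarith, by linarith [Real.pi_pos]⟩).ne'
  have hcos2 : Real.cos (2 * β) ≠ 0 :=
    (Real.cos_pos_of_mem_Ioo ⟨by linarith, by linarith [Real.pi_pos]⟩).ne'
  have hn' : (n : ℝ) ≠ 0 := by positivity
  have hA : Real.sin (2 * x * Real.sin β) ≠ 0 := by
    intro h
    simp [Real.tan_eq_sin_div_cos, h] at hx2
  have hsin4 : Real.sin (4 * β) = 4 * Real.sin β * Real.cos β * Real.cos (2 * β) := by
    rw [show 4 * β = 2 * (2 * β) by ring, Real.sin_two_mul, Real.sin_two_mul β]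
    ring
  have hpsi : psi ((Real.cos β)⁻¹ * (Real.cos (2 * β))⁻¹ * x) y (4 * β) =
      (Real.cos (2 * β))⁻¹ *
        Real.arctan (Real.tan (2 * x * Real.sin β) / Real.tanh (y * Real.sin (2 * β))) := by
    rw [psi, hsin4, show 4 * β / 2 = 2 * β by ring]
    congr 4
    field_simp
    ring
  have hphi (m : ℕ) : phi (2 * y / n) (2 * x / n + m * Real.pi / (n * Real.sin β)) (2 * β) =
      -(Real.cos β)⁻¹ * Real.arctan (Real.tanh (y * Real.sin (2 * β) / n) /
        Real.tan ((2 * x * Real.sin β + m * Real.pi) / n)) := by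
    rw [phi, show 2 * β / 2 = β by ring]
    congr 3
    · ring_nf
    · congr 1
      field_simp
  simp only [hpsi, hphi]
  rw [← Finset.mul_sum, ← Real.arctan_tanh_div_tan_eq_sum hn hA, ← inv_div (Real.tan _),
    Real.arctan_inv_of_pos hx2]
  field_simp
  ring
end

section
/- Let n be a positive integer and β ∈ (0, π/4). Let y, z ∈ ℝ satisfy y ≠ 0 and |tanh(z·sin β·cos β)| < |tanh(y·sin β)|. Assume that for every m ∈ {0, …, n−1}, the complex number tanh_ℂ((y·sin β − i·mπ)/n) is nonzero, and the quotient w_m := tanh((z·sin β·cos β)/n) / tanh_ℂ((y·sin β − i·mπ)/n) does not lie in the set (−∞, −1] ∪ [1, ∞) of real numbers. Then, as an equality of complex numbers, χ(y, z; 2β) = Σ_{m=0}^{n−1} sec β · artanh_ℂ( w_m ). -/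
open Real Complex

theorem artanhC_conj {w : ℂ} (hw : w ∉ artanhSlit) :
    artanhC ((starRingEnd ℂ) w) = (starRingEnd ℂ) (artanhC w) := by
  have hw1 : 1 - w ≠ 0 := fun h => hw (by
    rw [← sub_eq_zero.mp h]; simp [artanhSlit])
  have harg : ((1 + w) / (1 - w)).arg ≠ Real.pi := by
    intro h
    obtain ⟨hre, him⟩ := Complex.arg_eq_pi_iff.mp h
    set r := (1 + w) / (1 - w) with hr
    have hmul : 1 + w = r * (1 - w) := by rw [hr, div_mul_cancel₀ _ hw1]
    have h1 := congrArg Complex.re hmul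
    have h2 := congrArg Complex.im hmul
    simp only [Complex.add_re, Complex.one_re, Complex.mul_re, Complex.sub_re, Complex.sub_im,
      Complex.one_im, Complex.add_im, Complex.mul_im, him, zero_mul, sub_zero, add_zero,
      zero_add, zero_sub] at h1 h2
    have hr1 : 1 + r.re ≠ 0 := by
      intro h0
      rw [eq_neg_of_add_eq_zero_right h0] at h1
      linarith
    refine hw ⟨?_, ?_⟩
    · have : (1 + r.re) * w.im = 0 := by linarith
      exact (mul_eq_zero.mp this).resolve_left hr1
    · by_contra! hcon
      nlinarith [mul_neg_of_neg_of_pos hre (sub_pos.mpr hcon.2)]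
  have hlog := Complex.log_conj _ harg
  simp only [map_div₀, map_add, map_sub, map_one] at hlog
  rw [artanhC, artanhC, hlog]
  simp only [map_mul, map_div₀, map_one, map_ofNat]

theorem artanhC_re (w : ℂ) :
    (artanhC w).re = 1 / 2 * Real.log ‖(1 + w) / (1 - w)‖ := by
  have h : ((1 : ℂ) / 2) = ((1 / 2 : ℝ) : ℂ) := by push_cast; rfl
  rw [artanhC, h, Complex.re_ofReal_mul, Complex.log_re]

theorem artanhR_eq_log_norm (x : ℝ) :
    artanhR x = 1 / 2 * Real.log ‖(1 + (x : ℂ)) / (1 - x)‖ := by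
  rw [artanhR, ← Real.log_abs, ← Real.norm_eq_abs, ← Complex.norm_real]
  push_cast
  rfl

theorem one_add_div_one_sub_tanh_div_tanh {A : ℂ} (hA : Complex.tanh A ≠ 0) {B : ℂ}
    (hB : Complex.cosh B ≠ 0) :
    (1 + Complex.tanh B / Complex.tanh A) / (1 - Complex.tanh B / Complex.tanh A) =
      Complex.exp (2 * B) * (1 - Complex.exp (-2 * A) * Complex.exp (-2 * B)) /
        (1 - Complex.exp (-2 * A) * Complex.exp (2 * B)) := by
  have hs : Complex.sinh A ≠ 0 := fun h => hA (by rw [Complex.tanh_eq_sinh_div_cosh, h, zero_div])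
  have hc : Complex.cosh A ≠ 0 := fun h => hA (by rw [Complex.tanh_eq_sinh_div_cosh, h, div_zero])
  have hsinh : ∀ x : ℂ, Complex.sinh x = Complex.exp x * (1 - Complex.exp (-2 * x)) / 2 := by
    intro x
    rw [mul_sub, ← Complex.exp_add, Complex.sinh]
    ring_nf
  have e1 : 1 + Complex.tanh B / Complex.tanh A =
      Complex.sinh (A + B) / (Complex.sinh A * Complex.cosh B) := by
    rw [Complex.tanh_eq_sinh_div_cosh, Complex.tanh_eq_sinh_div_cosh, Complex.sinh_add]
    field_simp
  have e2 : 1 - Complex.tanh B / Complex.tanh A =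
      Complex.sinh (A - B) / (Complex.sinh A * Complex.cosh B) := by
    rw [Complex.tanh_eq_sinh_div_cosh, Complex.tanh_eq_sinh_div_cosh, Complex.sinh_sub]
    field_simp
  have e3 : Complex.exp (A + B) = Complex.exp (A - B) * Complex.exp (2 * B) := by
    rw [← Complex.exp_add]; ring_nf
  rw [e1, e2, div_div_div_cancel_right₀ (mul_ne_zero hs hB), hsinh, hsinh,
    div_div_div_cancel_right₀ two_ne_zero, e3, mul_assoc,
    mul_div_mul_left _ _ (Complex.exp_ne_zero _), ← Complex.exp_add, ← Complex.exp_add]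
  ring_nf

theorem prod_range_one_sub_primitiveRoot_pow_mul {n : ℕ} {ζ : ℂ} (hn : 0 < n)
    (hζ : IsPrimitiveRoot ζ n) (u : ℂ) :
    ∏ m ∈ Finset.range n, (1 - ζ ^ m * u) = 1 - u ^ n := by
  have := hζ.pow_sub_pow_eq_prod_sub_mul 1 u hn
  rw [one_pow] at this
  rw [this]
  refine Finset.prod_bij (fun m _ => ζ ^ m) ?_ ?_ ?_ ?_
  · intro m _
    rw [Polynomial.mem_nthRootsFinset hn, ← pow_mul, mul_comm, pow_mul, hζ.pow_eq_one, one_pow]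
  · intro i hi j hj h
    exact hζ.pow_inj (Finset.mem_range.mp hi) (Finset.mem_range.mp hj) h
  · intro x hx
    rw [Polynomial.mem_nthRootsFinset hn] at hx
    have : NeZero n := ⟨hn.ne'⟩
    obtain ⟨i, hi, rfl⟩ := hζ.eq_pow_of_pow_eq_one hx
    exact ⟨i, Finset.mem_range.mpr hi, rfl⟩
  · intros; rfl

theorem prod_one_add_div_one_sub_tanh {n : ℕ} (hn : 0 < n) (a b : ℝ)
    (ha : Complex.tanh a ≠ 0)
    (hne : ∀ m : ℕ, m < n →
      Complex.tanh (((a : ℂ) - Complex.I * m * Real.pi) / n) ≠ 0) :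
    ∏ m ∈ Finset.range n,
      (1 + ((Real.tanh (b / n) : ℝ) : ℂ) /
          Complex.tanh (((a : ℂ) - Complex.I * m * Real.pi) / n)) /
        (1 - ((Real.tanh (b / n) : ℝ) : ℂ) /
          Complex.tanh (((a : ℂ) - Complex.I * m * Real.pi) / n)) =
      (1 + ((Real.tanh b : ℝ) : ℂ) / Complex.tanh a) /
        (1 - ((Real.tanh b : ℝ) : ℂ) / Complex.tanh a) := by
  have hn0 : (n : ℂ) ≠ 0 := Nat.cast_ne_zero.mpr hn.ne'
  have hcosh : ∀ x : ℝ, Complex.cosh x ≠ 0 := fun x => by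
    rw [← Complex.ofReal_cosh]
    exact Complex.ofReal_ne_zero.mpr (Real.cosh_pos x).ne'
  have hζ := Complex.isPrimitiveRoot_exp n hn.ne'
  set ζ := Complex.exp (2 * Real.pi * Complex.I / n) with hζdef
  have hterm : ∀ m ∈ Finset.range n,
      (1 + ((Real.tanh (b / n) : ℝ) : ℂ) /
          Complex.tanh (((a : ℂ) - Complex.I * m * Real.pi) / n)) /
        (1 - ((Real.tanh (b / n) : ℝ) : ℂ) /
          Complex.tanh (((a : ℂ) - Complex.I * m * Real.pi) / n)) =
      Complex.exp (2 * (b / n)) *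
        (1 - ζ ^ m * (Complex.exp (-2 * (a / n)) * Complex.exp (-2 * (b / n)))) /
        (1 - ζ ^ m * (Complex.exp (-2 * (a / n)) * Complex.exp (2 * (b / n)))) := by
    intro m hm
    have hexp : Complex.exp (-2 * (((a : ℂ) - Complex.I * m * Real.pi) / n)) =
        ζ ^ m * Complex.exp (-2 * (a / n)) := by
      rw [hζdef, ← Complex.exp_nat_mul, ← Complex.exp_add]
      ring_nf
    have hB := hcosh (b / n)
    rw [Complex.ofReal_tanh,
      one_add_div_one_sub_tanh_div_tanh (hne m (Finset.mem_range.mp hm)) hB, hexp]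
    push_cast
    simp only [mul_assoc]
  have hscale : ∀ c x : ℂ, Complex.exp (c * (x / n)) ^ n = Complex.exp (c * x) := by
    intro c x
    rw [← Complex.exp_nat_mul]
    congr 1
    field_simp
  rw [Finset.prod_congr rfl hterm, Finset.prod_div_distrib, Finset.prod_mul_distrib,
    prod_range_one_sub_primitiveRoot_pow_mul hn hζ,
    prod_range_one_sub_primitiveRoot_pow_mul hn hζ, Finset.prod_const, Finset.card_range,
    mul_pow, mul_pow, hscale, hscale, hscale, Complex.ofReal_tanh,
    one_add_div_one_sub_tanh_div_tanh ha (hcosh b)]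

theorem tanh_reflect {n : ℕ} (hn : 0 < n) (a : ℝ) {m : ℕ} (hm : m ≤ n) :
    Complex.tanh (((a : ℂ) - Complex.I * (n - m : ℕ) * Real.pi) / n) =
      (starRingEnd ℂ) (Complex.tanh (((a : ℂ) - Complex.I * m * Real.pi) / n)) := by
  have hn0 : (n : ℂ) ≠ 0 := Nat.cast_ne_zero.mpr hn.ne'
  rw [← Complex.tanh_conj, ← Complex.tanh_sub_pi_mul_I ((starRingEnd ℂ) _)]
  simp only [map_div₀, map_sub, map_mul, Complex.conj_ofReal, Complex.conj_I, map_natCast]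
  rw [Nat.cast_sub hm]
  congr 1
  field_simp
  ring

theorem sum_artanhC_tanh_div_tanh {n : ℕ} (hn : 0 < n) (a b : ℝ) (ha : Real.tanh a ≠ 0)
    (hne : ∀ m : ℕ, m < n →
      Complex.tanh (((a : ℂ) - Complex.I * m * Real.pi) / n) ≠ 0)
    (hslit : ∀ m : ℕ, m < n →
      ((Real.tanh (b / n) : ℝ) : ℂ) /
          Complex.tanh (((a : ℂ) - Complex.I * m * Real.pi) / n) ∉ artanhSlit) :
    ∑ m ∈ Finset.range n, artanhC (((Real.tanh (b / n) : ℝ) : ℂ) /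
        Complex.tanh (((a : ℂ) - Complex.I * m * Real.pi) / n)) =
      (artanhR (Real.tanh b / Real.tanh a) : ℝ) := by
  have hprod := prod_one_add_div_one_sub_tanh hn a b
    (by rw [← Complex.ofReal_tanh]; exact Complex.ofReal_ne_zero.mpr ha) hne
  set w : ℕ → ℂ := fun m => ((Real.tanh (b / n) : ℝ) : ℂ) /
    Complex.tanh (((a : ℂ) - Complex.I * m * Real.pi) / n) with hw
  have hreflect : ∀ m < n, artanhC (w (n - m)) = (starRingEnd ℂ) (artanhC (w m)) := by
    intro m hm
    rw [← artanhC_conj (hslit m hm)]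
    simp only [hw]
    rw [tanh_reflect hn a hm.le, map_div₀, Complex.conj_ofReal]
  have hperiod : w n = w 0 := by
    have hn0 : (n : ℂ) ≠ 0 := Nat.cast_ne_zero.mpr hn.ne'
    simp only [hw]
    rw [← Complex.tanh_sub_pi_mul_I (((a : ℂ) - Complex.I * (0 : ℕ) * Real.pi) / n)]
    congr 2
    field_simp
    push_cast
    ring
  have hconj : (starRingEnd ℂ) (∑ m ∈ Finset.range n, artanhC (w m)) =
      ∑ m ∈ Finset.range n, artanhC (w m) := by
    have hshift : ∑ m ∈ Finset.range n, artanhC (w (m + 1)) =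
        ∑ m ∈ Finset.range n, artanhC (w m) := by
      have h := (Finset.sum_range_succ' (fun m => artanhC (w m)) n).symm.trans
        (Finset.sum_range_succ (fun m => artanhC (w m)) n)
      rw [hperiod] at h
      exact add_right_cancel h
    rw [map_sum, ← hshift, ← Finset.sum_range_reflect]
    refine Finset.sum_congr rfl fun m hm => ?_
    have hm' := Finset.mem_range.mp hm
    rw [← hreflect (n - 1 - m) (by omega)]
    congr 2
    omega
  rw [← Complex.conj_eq_iff_re.mp hconj]
  congr 1
  have hnz : ∀ m ∈ Finset.range n, ‖(1 + w m) / (1 - w m)‖ ≠ 0 := by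
    intro m hm
    have h := hslit m (Finset.mem_range.mp hm)
    refine norm_ne_zero_iff.mpr (div_ne_zero (fun h0 => h ?_) (fun h0 => h ?_))
    · change w m ∈ artanhSlit
      rw [eq_neg_of_add_eq_zero_right h0]
      simp [artanhSlit]
    · change w m ∈ artanhSlit
      rw [← sub_eq_zero.mp h0]
      simp [artanhSlit]
  rw [Complex.re_sum, Finset.sum_congr rfl fun m _ => artanhC_re (w m), ← Finset.mul_sum,
    ← Real.log_prod hnz, ← norm_prod, hprod, artanhR_eq_log_norm]
  push_cast
  rfl

/-- Finite decomposition of Scherk's type Born–Infeld solitons into dilated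
copies of themselves, as an equality of complex numbers. -/
theorem chi_finite_decomposition (n : ℕ) (hn : 0 < n)
    (β : ℝ) (hβ0 : 0 < β) (hβ1 : β < Real.pi / 4)
    (y z : ℝ) (hy : y ≠ 0)
    (hlt : |Real.tanh (z * Real.sin β * Real.cos β)| < |Real.tanh (y * Real.sin β)|)
    (hne : ∀ m : ℕ, m < n →
      Complex.tanh ((((y * Real.sin β : ℝ) : ℂ) - Complex.I * m * Real.pi) / n) ≠ 0)
    (hslit : ∀ m : ℕ, m < n →
      ((Real.tanh (z * Real.sin β * Real.cos β / n) : ℝ) : ℂ) /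
          Complex.tanh ((((y * Real.sin β : ℝ) : ℂ) - Complex.I * m * Real.pi) / n)
        ∉ artanhSlit) :
    ((chi y z (2 * β) : ℝ) : ℂ) =
      ∑ m ∈ Finset.range n,
        ((Real.cos β : ℝ) : ℂ)⁻¹ *
          artanhC (((Real.tanh (z * Real.sin β * Real.cos β / n) : ℝ) : ℂ) /
            Complex.tanh ((((y * Real.sin β : ℝ) : ℂ) - Complex.I * m * Real.pi) / n)) := by
  have ha : Real.tanh (y * Real.sin β) ≠ 0 := abs_pos.mp ((abs_nonneg _).trans_lt hlt)
  rw [← Finset.mul_sum, sum_artanhC_tanh_div_tanh hn _ _ ha hne hslit, chi,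
    mul_div_cancel_left₀ β two_ne_zero, Real.sin_two_mul,
    show z * (2 * Real.sin β * Real.cos β) / 2 = z * Real.sin β * Real.cos β by ring]
  push_cast
  rfl
end

section
/- Let F : ℂ × ℂ → ℂ be analytic on all of ℂ × ℂ, real-valued at all real arguments, and even in each variable, i.e. F(−z, w) = F(z, w) and F(z, −w) = F(z, w) for all z, w ∈ ℂ. Suppose the real function f(x, y) := F(x, y) (for x, y ∈ ℝ) satisfies the minimal surface equation at every point of ℝ². Then g(x, y) := F(i·x, i·y) is real for all real x, y, the resulting real function g satisfies the zero mean curvature equation at every point of ℝ², and there is a neighborhood of the origin (0,0) on which g_x² + g_y² < 1. -/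
open Real Complex Filter

/-- Partial derivative with respect to the first variable. -/
noncomputable def partialX (f : ℝ → ℝ → ℝ) (x y : ℝ) : ℝ := deriv (fun t => f t y) x

/-- Partial derivative with respect to the second variable. -/
noncomputable def partialY (f : ℝ → ℝ → ℝ) (x y : ℝ) : ℝ := deriv (fun t => f x t) y

/-- `f` satisfies the minimal surface equation at `(x, y)`. -/
def SatisfiesMSE (f : ℝ → ℝ → ℝ) (x y : ℝ) : Prop :=
  (1 + (partialX f x y) ^ 2) * partialY (partialY f) x y
    - 2 * partialX f x y * partialY f x y * partialY (partialX f) x y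
    + (1 + (partialY f x y) ^ 2) * partialX (partialX f) x y = 0

/-- `g` satisfies the zero mean curvature equation at `(x, y)`. -/
def SatisfiesZMC (g : ℝ → ℝ → ℝ) (x y : ℝ) : Prop :=
  (1 - (partialX g x y) ^ 2) * partialY (partialY g) x y
    + 2 * partialX g x y * partialY g x y * partialY (partialX g) x y
    + (1 - (partialY g x y) ^ 2) * partialX (partialX g) x y = 0

/-- `h = h(y, z)` (first variable `y`, second variable `z`) satisfies the
Born–Infeld equation at `(y, z)`. -/
def SatisfiesBIE (h : ℝ → ℝ → ℝ) (y z : ℝ) : Prop :=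
  (1 + (partialX h y z) ^ 2) * partialY (partialY h) y z
    - 2 * partialX h y z * partialY h y z * partialY (partialX h) y z
    + ((partialY h y z) ^ 2 - 1) * partialX (partialX h) y z = 0

/-- Two entire functions agreeing on the real line are equal. -/
theorem entire_ext_of_real {h k : ℂ → ℂ} (hh : Differentiable ℂ h) (hk : Differentiable ℂ k)
    (hhk : ∀ x : ℝ, h x = k x) : h = k := by
  refine AnalyticOnNhd.eq_of_frequently_eq (𝕜 := ℂ) (z₀ := 0)
    (fun z _ => hh.analyticAt z) (fun z _ => hk.analyticAt z) ?_
  have ht : Tendsto (fun x : ℝ => (x : ℂ)) (nhdsWithin 0 {0}ᶜ) (nhdsWithin 0 {0}ᶜ) := by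
    refine tendsto_nhdsWithin_of_tendsto_nhds_of_eventually_within _ ?_ ?_
    · simpa using (Complex.continuous_ofReal.tendsto 0).mono_left nhdsWithin_le_nhds
    · filter_upwards [self_mem_nhdsWithin] with x hx
      simpa using hx
  exact ht.frequently (Eventually.frequently (Eventually.of_forall hhk))

/-- An entire function of two variables vanishing at all real points vanishes identically. -/
theorem entire₂_eq_zero_of_real {H : ℂ × ℂ → ℂ} (hH : Differentiable ℂ H)
    (h0 : ∀ x y : ℝ, H (x, y) = 0) (z w : ℂ) : H (z, w) = 0 := by
  have h1 (y : ℝ) : (fun z : ℂ => H (z, y)) = fun _ => 0 :=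
    entire_ext_of_real (by fun_prop) (by fun_prop) fun x => h0 x y
  have h2 : (fun w : ℂ => H (z, w)) = fun _ => 0 :=
    entire_ext_of_real (by fun_prop) (by fun_prop) fun y => congrFun (h1 y) z
  exact congrFun h2 w

/-- An even entire function that is real on the real axis is real on the imaginary axis. -/
theorem im_eq_zero_of_even {h : ℂ → ℂ} (hh : Differentiable ℂ h)
    (hr : ∀ x : ℝ, (h x).im = 0) (he : ∀ z, h (-z) = h z) (x : ℝ) :
    (h (Complex.I * x)).im = 0 := by
  have hs : (fun z => starRingEnd ℂ (h (starRingEnd ℂ z))) = h := by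
    refine entire_ext_of_real (fun z => ?_) hh fun x => ?_
    · exact differentiableAt_conj_conj_iff.2 (hh _)
    · simpa [Complex.conj_eq_iff_im] using hr x
  have := congrFun hs (Complex.I * x)
  simp only [map_mul, Complex.conj_I, Complex.conj_ofReal, neg_mul, he] at this
  exact Complex.conj_eq_iff_im.1 this

/-- The derivative at a real point of a function that is real on the real axis is real. -/
theorem HasDerivAt.im_eq_zero_of_real {h : ℂ → ℂ} {d : ℂ} {x : ℝ} (hd : HasDerivAt h d x)
    (hr : ∀ x : ℝ, (h x).im = 0) : d.im = 0 := by
  have h1 := (hd.const_mul (-Complex.I)).real_of_complex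
  have h2 : (fun x : ℝ => (-Complex.I * h x).re) = fun _ => 0 := by
    funext t; simp [hr]
  rw [h2] at h1
  simpa using h1.unique (hasDerivAt_const x (0 : ℝ))

/-- The derivative of `F` in the direction `v`, as a function of the base point. -/
noncomputable def dirDeriv (v : ℂ × ℂ) (F : ℂ × ℂ → ℂ) (p : ℂ × ℂ) : ℂ := fderiv ℂ F p v

theorem analyticOnNhd_dirDeriv {F : ℂ × ℂ → ℂ} (hF : AnalyticOnNhd ℂ F Set.univ) (v : ℂ × ℂ) :
    AnalyticOnNhd ℂ (dirDeriv v F) Set.univ :=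
  (ContinuousLinearMap.apply ℂ ℂ v).comp_analyticOnNhd hF.fderiv

theorem hasDerivAt_fst {F : ℂ × ℂ → ℂ} (hF : AnalyticOnNhd ℂ F Set.univ) (z w : ℂ) :
    HasDerivAt (fun t => F (t, w)) (dirDeriv (1, 0) F (z, w)) z :=
  (hF (z, w) trivial).differentiableAt.hasFDerivAt.comp_hasDerivAt z
    ((hasDerivAt_id z).prodMk (hasDerivAt_const z w))

theorem hasDerivAt_snd {F : ℂ × ℂ → ℂ} (hF : AnalyticOnNhd ℂ F Set.univ) (z w : ℂ) :
    HasDerivAt (fun t => F (z, t)) (dirDeriv (0, 1) F (z, w)) w :=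
  (hF (z, w) trivial).differentiableAt.hasFDerivAt.comp_hasDerivAt w
    ((hasDerivAt_const w z).prodMk (hasDerivAt_id w))

theorem dirDeriv_mul_comp_smul {F : ℂ × ℂ → ℂ} (hF : AnalyticOnNhd ℂ F Set.univ) (k c : ℂ)
    (v : ℂ × ℂ) :
    dirDeriv v (fun p => k * F (c • p)) = fun p => k * c * dirDeriv v F (c • p) := by
  funext p
  have h := (((hF (c • p) trivial).differentiableAt.hasFDerivAt.comp p
    ((hasFDerivAt_id p).const_smul c)).const_mul k).fderiv
  simp only [dirDeriv]
  refine (DFunLike.congr_fun h v).trans ?_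
  simp
  ring

/-- Real part of a complex function of two variables, at real arguments. -/
noncomputable def realRestrict (F : ℂ × ℂ → ℂ) (x y : ℝ) : ℝ := (F (x, y)).re

theorem partialX_realRestrict {F : ℂ × ℂ → ℂ} (hF : AnalyticOnNhd ℂ F Set.univ) :
    partialX (realRestrict F) = realRestrict (dirDeriv (1, 0) F) := by
  funext x y
  exact (hasDerivAt_fst hF x y).real_of_complex.deriv

theorem partialY_realRestrict {F : ℂ × ℂ → ℂ} (hF : AnalyticOnNhd ℂ F Set.univ) :
    partialY (realRestrict F) = realRestrict (dirDeriv (0, 1) F) := by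
  funext x y
  exact (hasDerivAt_snd hF x y).real_of_complex.deriv

/-- `F` is real at real arguments. -/
def RealOnReal (F : ℂ × ℂ → ℂ) : Prop := ∀ x y : ℝ, (F (x, y)).im = 0

theorem RealOnReal.ofReal_realRestrict {F : ℂ × ℂ → ℂ} (h : RealOnReal F) (x y : ℝ) :
    (realRestrict F x y : ℂ) = F (x, y) :=
  Complex.ext rfl (h x y).symm

theorem RealOnReal.dirDeriv_fst {F : ℂ × ℂ → ℂ} (h : RealOnReal F)
    (hF : AnalyticOnNhd ℂ F Set.univ) : RealOnReal (dirDeriv (1, 0) F) :=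
  fun x y => (hasDerivAt_fst hF x y).im_eq_zero_of_real fun t => h t y

theorem RealOnReal.dirDeriv_snd {F : ℂ × ℂ → ℂ} (h : RealOnReal F)
    (hF : AnalyticOnNhd ℂ F Set.univ) : RealOnReal (dirDeriv (0, 1) F) :=
  fun x y => (hasDerivAt_snd hF x y).im_eq_zero_of_real fun t => h x t

/-- The complexified left-hand side of the minimal surface equation (`ε = 1`) or the zero mean
curvature equation (`ε = -1`). -/
noncomputable def meanCurvatureOp (ε : ℂ) (F : ℂ × ℂ → ℂ) (p : ℂ × ℂ) : ℂ :=
  (1 + ε * dirDeriv (1, 0) F p ^ 2) * dirDeriv (0, 1) (dirDeriv (0, 1) F) p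
    - ε * 2 * dirDeriv (1, 0) F p * dirDeriv (0, 1) F p * dirDeriv (0, 1) (dirDeriv (1, 0) F) p
    + (1 + ε * dirDeriv (0, 1) F p ^ 2) * dirDeriv (1, 0) (dirDeriv (1, 0) F) p

theorem differentiable_meanCurvatureOp {F : ℂ × ℂ → ℂ} (hF : AnalyticOnNhd ℂ F Set.univ) (ε : ℂ) :
    Differentiable ℂ (meanCurvatureOp ε F) := by
  have hd {G : ℂ × ℂ → ℂ} (hG : AnalyticOnNhd ℂ G Set.univ) : Differentiable ℂ G :=
    fun p => (hG p trivial).differentiableAt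
  have hX := analyticOnNhd_dirDeriv hF (1, 0)
  have hY := analyticOnNhd_dirDeriv hF (0, 1)
  have h1 := hd hX
  have h2 := hd hY
  have h3 := hd (analyticOnNhd_dirDeriv hX (1, 0))
  have h4 := hd (analyticOnNhd_dirDeriv hX (0, 1))
  have h5 := hd (analyticOnNhd_dirDeriv hY (0, 1))
  unfold meanCurvatureOp
  fun_prop

theorem satisfiesMSE_iff {F : ℂ × ℂ → ℂ} (hF : AnalyticOnNhd ℂ F Set.univ) (hr : RealOnReal F)
    (x y : ℝ) : SatisfiesMSE (realRestrict F) x y ↔ meanCurvatureOp 1 F (x, y) = 0 := by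
  have hX := analyticOnNhd_dirDeriv hF (1, 0)
  have hY := analyticOnNhd_dirDeriv hF (0, 1)
  have rX := hr.dirDeriv_fst hF
  have rY := hr.dirDeriv_snd hF
  simp only [SatisfiesMSE, partialX_realRestrict hF, partialY_realRestrict hF,
    partialX_realRestrict hX, partialY_realRestrict hX, partialY_realRestrict hY, meanCurvatureOp,
    ← rX.ofReal_realRestrict, ← rY.ofReal_realRestrict,
    ← (rX.dirDeriv_fst hX).ofReal_realRestrict, ← (rX.dirDeriv_snd hX).ofReal_realRestrict,
    ← (rY.dirDeriv_snd hY).ofReal_realRestrict, one_mul]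
  norm_cast

theorem satisfiesZMC_iff {F : ℂ × ℂ → ℂ} (hF : AnalyticOnNhd ℂ F Set.univ) (hr : RealOnReal F)
    (x y : ℝ) : SatisfiesZMC (realRestrict F) x y ↔ meanCurvatureOp (-1) F (x, y) = 0 := by
  have hX := analyticOnNhd_dirDeriv hF (1, 0)
  have hY := analyticOnNhd_dirDeriv hF (0, 1)
  have rX := hr.dirDeriv_fst hF
  have rY := hr.dirDeriv_snd hF
  simp only [SatisfiesZMC, partialX_realRestrict hF, partialY_realRestrict hF,
    partialX_realRestrict hX, partialY_realRestrict hX, partialY_realRestrict hY, meanCurvatureOp,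
    ← rX.ofReal_realRestrict, ← rY.ofReal_realRestrict,
    ← (rX.dirDeriv_fst hX).ofReal_realRestrict, ← (rX.dirDeriv_snd hX).ofReal_realRestrict,
    ← (rY.dirDeriv_snd hY).ofReal_realRestrict, neg_mul, one_mul, ← sub_eq_add_neg, sub_neg_eq_add]
  norm_cast

theorem meanCurvatureOp_comp_I_smul {F : ℂ × ℂ → ℂ} (hF : AnalyticOnNhd ℂ F Set.univ)
    (p : ℂ × ℂ) :
    meanCurvatureOp (-1) (fun p => F (Complex.I • p)) p
      = -meanCurvatureOp 1 F (Complex.I • p) := by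
  have h1 (v : ℂ × ℂ) : dirDeriv v (fun p => F (Complex.I • p))
      = fun p => Complex.I * dirDeriv v F (Complex.I • p) := by
    simpa using dirDeriv_mul_comp_smul hF 1 Complex.I v
  have h2 (v w : ℂ × ℂ) := dirDeriv_mul_comp_smul (analyticOnNhd_dirDeriv hF v)
    Complex.I Complex.I w
  simp only [meanCurvatureOp, h1, h2]
  ring_nf
  simp only [Complex.I_sq, Complex.I_pow_four]
  ring

theorem HasDerivAt.eq_zero_of_even {h : ℂ → ℂ} {d : ℂ} (hd : HasDerivAt h d 0)
    (he : ∀ z, h (-z) = h z) : d = 0 := by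
  have hn : HasDerivAt (fun z => h (-z)) (d * -1) 0 :=
    HasDerivAt.comp (0 : ℂ) (by simpa using hd) (hasDerivAt_neg 0)
  rw [funext he] at hn
  have := hd.unique hn
  linear_combination (1 / 2 : ℂ) * this

/-- Wick rotation of an even solution of the minimal surface equation gives a real
solution of the zero mean curvature equation, spacelike near the origin. -/
theorem wick_even_minimal_to_maximal (F : ℂ × ℂ → ℂ)
    (hF : AnalyticOnNhd ℂ F Set.univ)
    (hreal : ∀ x y : ℝ, (F ((x : ℂ), (y : ℂ))).im = 0)
    (heven1 : ∀ z w : ℂ, F (-z, w) = F (z, w))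
    (heven2 : ∀ z w : ℂ, F (z, -w) = F (z, w))
    (hmin : ∀ x y : ℝ, SatisfiesMSE (fun x y : ℝ => (F ((x : ℂ), (y : ℂ))).re) x y) :
    (∀ x y : ℝ, (F (Complex.I * x, Complex.I * y)).im = 0) ∧
    (∀ x y : ℝ,
      SatisfiesZMC (fun x y : ℝ => (F (Complex.I * x, Complex.I * y)).re) x y) ∧
    ∃ U ∈ nhds ((0 : ℝ), (0 : ℝ)), ∀ p ∈ U,
      (partialX (fun x y : ℝ => (F (Complex.I * x, Complex.I * y)).re) p.1 p.2) ^ 2 +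
        (partialY (fun x y : ℝ => (F (Complex.I * x, Complex.I * y)).re) p.1 p.2) ^ 2
        < 1 := by
  set G : ℂ × ℂ → ℂ := fun p => F (Complex.I • p) with hGdef
  have hdF : Differentiable ℂ F := fun p => (hF p trivial).differentiableAt
  have hG : AnalyticOnNhd ℂ G Set.univ := fun p _ =>
    AnalyticAt.comp (hF _ trivial) (analyticAt_id.const_smul (c := Complex.I))
  have hGr : RealOnReal G := by
    intro x y
    have h1 (t : ℝ) : (F (Complex.I * x, t)).im = 0 :=
      im_eq_zero_of_even (h := fun z => F (z, t)) (by fun_prop) (fun s => hreal s t)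
        (fun z => heven1 z t) x
    exact im_eq_zero_of_even (h := fun w => F (Complex.I * x, w)) (by fun_prop) h1
      (fun w => heven2 _ w) y
  have hGX := partialX_realRestrict hG
  have hGY := partialY_realRestrict hG
  change RealOnReal G ∧ (∀ x y, SatisfiesZMC (realRestrict G) x y) ∧
    ∃ U ∈ nhds ((0 : ℝ), (0 : ℝ)), ∀ p ∈ U, (partialX (realRestrict G) p.1 p.2) ^ 2 +
        (partialY (realRestrict G) p.1 p.2) ^ 2 < 1
  refine ⟨hGr, fun x y => ?_, ?_⟩
  · rw [satisfiesZMC_iff hG hGr, hGdef, meanCurvatureOp_comp_I_smul hF, neg_eq_zero]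
    exact entire₂_eq_zero_of_real (differentiable_meanCurvatureOp hF 1)
      (fun x y => (satisfiesMSE_iff hF hreal x y).1 (hmin x y)) _ _
  · have cX : Continuous (dirDeriv (1, 0) G) := continuousOn_univ.1
      (analyticOnNhd_dirDeriv hG (1, 0)).continuousOn
    have cY : Continuous (dirDeriv (0, 1) G) := continuousOn_univ.1
      (analyticOnNhd_dirDeriv hG (0, 1)).continuousOn
    have zX : dirDeriv (1, 0) G (0, 0) = 0 :=
      (hasDerivAt_fst hG 0 0).eq_zero_of_even fun z => by simp [hGdef, heven1]
    have zY : dirDeriv (0, 1) G (0, 0) = 0 :=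
      (hasDerivAt_snd hG 0 0).eq_zero_of_even fun z => by simp [hGdef, heven2]
    refine ⟨{p | (partialX (realRestrict G) p.1 p.2) ^ 2 +
        (partialY (realRestrict G) p.1 p.2) ^ 2 < 1}, ?_, fun p hp => hp⟩
    rw [hGX, hGY]
    unfold realRestrict
    refine IsOpen.mem_nhds (isOpen_lt (by fun_prop) continuous_const) ?_
    simp [zX, zY]
end

section
/- Let F : ℂ × ℂ → ℂ be analytic on all of ℂ × ℂ, real-valued at all real arguments, and even in its second variable, i.e. F(z, −w) = F(z, w) for all z, w ∈ ℂ. Suppose the real function f(x, y) := F(x, y) (for x, y ∈ ℝ) satisfies the minimal surface equation at every point of ℝ². Then h(y, z) := F(y, i·z) is real for all real y, z, and the resulting real function h satisfies the Born–Infeld equation at every point of ℝ². -/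
open Real Complex Filter

open scoped Topology ComplexConjugate

/-- The complex partial derivative of `G` in the first variable. -/
noncomputable def complexPartialX (G : ℂ × ℂ → ℂ) (p : ℂ × ℂ) : ℂ := fderiv ℂ G p (1, 0)

/-- The complex partial derivative of `G` in the second variable. -/
noncomputable def complexPartialY (G : ℂ × ℂ → ℂ) (p : ℂ × ℂ) : ℂ := fderiv ℂ G p (0, 1)

/-- `G` is entire on `ℂ × ℂ` and takes real values at real arguments. -/
structure IsRealEntire (G : ℂ × ℂ → ℂ) : Prop where
  analytic : AnalyticOnNhd ℂ G Set.univ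
  im_eq_zero : ∀ x y : ℝ, (G ((x : ℂ), (y : ℂ))).im = 0

/-- The real function of two real variables given by the real part of `G`. -/
def realRestriction (G : ℂ × ℂ → ℂ) (x y : ℝ) : ℝ := (G ((x : ℂ), (y : ℂ))).re

theorem hasDerivAt_complexPartialX {G : ℂ × ℂ → ℂ} (hG : AnalyticOnNhd ℂ G Set.univ)
    (z w : ℂ) : HasDerivAt (fun t => G (t, w)) (complexPartialX G (z, w)) z :=
  (hG (z, w) (Set.mem_univ _)).differentiableAt.hasFDerivAt.comp_hasDerivAt z
    ((hasDerivAt_id z).prodMk (hasDerivAt_const z w))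

theorem hasDerivAt_complexPartialY {G : ℂ × ℂ → ℂ} (hG : AnalyticOnNhd ℂ G Set.univ)
    (z w : ℂ) : HasDerivAt (fun t => G (z, t)) (complexPartialY G (z, w)) w :=
  (hG (z, w) (Set.mem_univ _)).differentiableAt.hasFDerivAt.comp_hasDerivAt w
    ((hasDerivAt_const w z).prodMk (hasDerivAt_id w))

theorem analyticOnNhd_complexPartialX {G : ℂ × ℂ → ℂ} (hG : AnalyticOnNhd ℂ G Set.univ) :
    AnalyticOnNhd ℂ (complexPartialX G) Set.univ := fun p hp =>
  ((ContinuousLinearMap.apply ℂ ℂ ((1, 0) : ℂ × ℂ)).analyticAt _).comp (hG.fderiv p hp)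

theorem analyticOnNhd_complexPartialY {G : ℂ × ℂ → ℂ} (hG : AnalyticOnNhd ℂ G Set.univ) :
    AnalyticOnNhd ℂ (complexPartialY G) Set.univ := fun p hp =>
  ((ContinuousLinearMap.apply ℂ ℂ ((0, 1) : ℂ × ℂ)).analyticAt _).comp (hG.fderiv p hp)

/-- The derivative at a real point of a function that is real on the real line is real. -/
theorem HasDerivAt.im_eq_zero_of_real_s11 {e : ℂ → ℂ} {e' : ℂ} {x : ℝ}
    (he : HasDerivAt e e' (x : ℂ)) (hreal : ∀ t : ℝ, (e t).im = 0) : e'.im = 0 := by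
  have h : HasDerivAt (fun t : ℝ => (e t).im) e'.im x :=
    Complex.imCLM.hasFDerivAt.comp_hasDerivAt x he.comp_ofReal
  simp only [hreal] at h
  exact h.unique (hasDerivAt_const x 0)

namespace IsRealEntire

variable {G : ℂ × ℂ → ℂ}

theorem partialX (hG : IsRealEntire G) : IsRealEntire (complexPartialX G) where
  analytic := analyticOnNhd_complexPartialX hG.analytic
  im_eq_zero x y := (hasDerivAt_complexPartialX hG.analytic x y).im_eq_zero_of_real_s11
    fun t => hG.im_eq_zero t y

theorem partialY (hG : IsRealEntire G) : IsRealEntire (complexPartialY G) where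
  analytic := analyticOnNhd_complexPartialY hG.analytic
  im_eq_zero x y := (hasDerivAt_complexPartialY hG.analytic x y).im_eq_zero_of_real_s11
    fun t => hG.im_eq_zero x t

theorem partialX_realRestriction (hG : IsRealEntire G) :
    _root_.partialX (realRestriction G) = realRestriction (complexPartialX G) := by
  funext x y
  exact (hasDerivAt_complexPartialX hG.analytic x y).real_of_complex.deriv

theorem partialY_realRestriction (hG : IsRealEntire G) :
    _root_.partialY (realRestriction G) = realRestriction (complexPartialY G) := by
  funext x y
  exact (hasDerivAt_complexPartialY hG.analytic x y).real_of_complex.deriv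

theorem ofReal_realRestriction (hG : IsRealEntire G) (x y : ℝ) :
    (realRestriction G x y : ℂ) = G (x, y) :=
  Complex.ext (Complex.ofReal_re _) ((Complex.ofReal_im _).trans (hG.im_eq_zero x y).symm)

end IsRealEntire

/-- An entire function vanishing on the real line vanishes identically. -/
theorem Differentiable.eq_zero_of_real {g : ℂ → ℂ} (hg : Differentiable ℂ g)
    (h0 : ∀ x : ℝ, g x = 0) (z : ℂ) : g z = 0 := by
  have hlim : Tendsto (fun x : ℝ => (x : ℂ)) (𝓝[≠] 0) (𝓝[≠] ((0 : ℝ) : ℂ)) :=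
    tendsto_nhdsWithin_of_tendsto_nhds_of_eventually_within _
      (Complex.continuous_ofReal.continuousAt.mono_left nhdsWithin_le_nhds)
      (eventually_mem_nhdsWithin.mono fun x hx => by simpa using hx)
  have hfreq : ∃ᶠ z in 𝓝[≠] ((0 : ℝ) : ℂ), g z = 0 :=
    hlim.frequently (Frequently.of_forall h0)
  exact AnalyticOnNhd.eqOn_zero_of_preconnected_of_frequently_eq_zero
    (fun w _ => hg.analyticAt w) isPreconnected_univ (Set.mem_univ _) hfreq (Set.mem_univ z)

/-- A separately entire function vanishing on `ℝ × ℝ` vanishes identically. -/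
theorem eq_zero_of_separately_differentiable {G : ℂ × ℂ → ℂ}
    (hX : ∀ w, Differentiable ℂ fun z => G (z, w))
    (hY : ∀ z, Differentiable ℂ fun w => G (z, w))
    (h0 : ∀ x y : ℝ, G (x, y) = 0) (z w : ℂ) : G (z, w) = 0 :=
  (hY z).eq_zero_of_real (fun y => (hX y).eq_zero_of_real (fun x => h0 x y) z) w

/-- The Schwarz reflection symmetry. -/
theorem IsRealEntire.conj_apply_conj {G : ℂ × ℂ → ℂ} (hG : IsRealEntire G) (z w : ℂ) :
    conj (G (conj z, conj w)) = G (z, w) := by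
  have hX (w : ℂ) : Differentiable ℂ fun z => G (z, w) := fun z =>
    (hasDerivAt_complexPartialX hG.analytic z w).differentiableAt
  have hY (z : ℂ) : Differentiable ℂ fun w => G (z, w) := fun w =>
    (hasDerivAt_complexPartialY hG.analytic z w).differentiableAt
  refine sub_eq_zero.1 (eq_zero_of_separately_differentiable
    (G := fun p => conj (G (conj p.1, conj p.2)) - G p) (fun w => ?_) (fun z => ?_)
    (fun x y => ?_) z w)
  · exact Differentiable.sub (fun z => differentiableAt_conj_conj_iff.2 (hX (conj w) (conj z))) (hX w)
  · exact Differentiable.sub (fun w => differentiableAt_conj_conj_iff.2 (hY (conj z) (conj w))) (hY z)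
  · simp only [Complex.conj_ofReal, sub_eq_zero]
    exact Complex.conj_eq_iff_im.2 (hG.im_eq_zero x y)

/-- The Wick rotation of `G` in the second variable. -/
noncomputable def wickRotation (G : ℂ × ℂ → ℂ) (p : ℂ × ℂ) : ℂ := G (p.1, Complex.I * p.2)

theorem analyticOnNhd_wickRotation {G : ℂ × ℂ → ℂ} (hG : AnalyticOnNhd ℂ G Set.univ) :
    AnalyticOnNhd ℂ (wickRotation G) Set.univ := fun p _ =>
  AnalyticAt.comp₂ (h := G) (f := fun q : ℂ × ℂ => q.1) (g := fun q : ℂ × ℂ => Complex.I * q.2)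
    (hG (p.1, Complex.I * p.2) (Set.mem_univ _)) analyticAt_fst
    (analyticAt_const.mul analyticAt_snd)

theorem complexPartialX_wickRotation {G : ℂ × ℂ → ℂ} (hG : AnalyticOnNhd ℂ G Set.univ) :
    complexPartialX (wickRotation G) = wickRotation (complexPartialX G) := by
  funext ⟨z, w⟩
  exact (hasDerivAt_complexPartialX (analyticOnNhd_wickRotation hG) z w).unique
    (hasDerivAt_complexPartialX hG z (Complex.I * w))

theorem complexPartialY_wickRotation {G : ℂ × ℂ → ℂ} (hG : AnalyticOnNhd ℂ G Set.univ) :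
    complexPartialY (wickRotation G) = fun p => Complex.I * wickRotation (complexPartialY G) p := by
  funext ⟨z, w⟩
  refine (hasDerivAt_complexPartialY (analyticOnNhd_wickRotation hG) z w).unique ?_
  have h := (hasDerivAt_complexPartialY hG z (Complex.I * w)).comp w
    ((hasDerivAt_id w).const_mul Complex.I)
  rw [mul_one, mul_comm] at h
  exact h

theorem complexPartialY_const_mul {G : ℂ × ℂ → ℂ} (hG : AnalyticOnNhd ℂ G Set.univ) (c : ℂ) :
    complexPartialY (fun p => c * G p) = fun p => c * complexPartialY G p := by
  funext ⟨z, w⟩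
  exact (hasDerivAt_complexPartialY (fun p hp => analyticAt_const.mul (hG p hp)) z w).unique
    ((hasDerivAt_complexPartialY hG z w).const_mul c)

/-- The left-hand side of the minimal surface equation, for complex partial derivatives. -/
noncomputable def complexMSE (G : ℂ × ℂ → ℂ) (p : ℂ × ℂ) : ℂ :=
  (1 + complexPartialX G p ^ 2) * complexPartialY (complexPartialY G) p
    - 2 * complexPartialX G p * complexPartialY G p * complexPartialY (complexPartialX G) p
    + (1 + complexPartialY G p ^ 2) * complexPartialX (complexPartialX G) p

theorem analyticOnNhd_complexMSE {G : ℂ × ℂ → ℂ} (hG : AnalyticOnNhd ℂ G Set.univ) :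
    AnalyticOnNhd ℂ (complexMSE G) Set.univ := by
  have hX := analyticOnNhd_complexPartialX hG
  have hY := analyticOnNhd_complexPartialY hG
  exact (((analyticOnNhd_const.add (hX.pow 2)).mul (analyticOnNhd_complexPartialY hY)).sub
    (((analyticOnNhd_const.mul hX).mul hY).mul (analyticOnNhd_complexPartialY hX))).add
    ((analyticOnNhd_const.add (hY.pow 2)).mul (analyticOnNhd_complexPartialX hX))

/-- The minimal surface equation on `ℝ × ℝ` extends to `ℂ × ℂ`. -/
theorem IsRealEntire.complexMSE_eq_zero {G : ℂ × ℂ → ℂ} (hG : IsRealEntire G)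
    (hmin : ∀ x y : ℝ, SatisfiesMSE (realRestriction G) x y) (z w : ℂ) :
    complexMSE G (z, w) = 0 := by
  have hM := analyticOnNhd_complexMSE hG.analytic
  refine eq_zero_of_separately_differentiable
    (fun w z => (hasDerivAt_complexPartialX hM z w).differentiableAt)
    (fun z w => (hasDerivAt_complexPartialY hM z w).differentiableAt) (fun x y => ?_) z w
  have h := congrArg (fun r : ℝ => (r : ℂ)) (hmin x y)
  rw [hG.partialX_realRestriction, hG.partialY_realRestriction,
    hG.partialX.partialX_realRestriction, hG.partialX.partialY_realRestriction,
    hG.partialY.partialY_realRestriction] at h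
  push_cast at h
  rwa [hG.partialX.ofReal_realRestriction, hG.partialY.ofReal_realRestriction,
    hG.partialX.partialX.ofReal_realRestriction, hG.partialX.partialY.ofReal_realRestriction,
    hG.partialY.partialY.ofReal_realRestriction] at h

/-- The Wick rotation of a real entire function even in the second variable is real entire. -/
theorem IsRealEntire.wickRotation {G : ℂ × ℂ → ℂ} (hG : IsRealEntire G)
    (heven : ∀ z w : ℂ, G (z, -w) = G (z, w)) : IsRealEntire (wickRotation G) where
  analytic := analyticOnNhd_wickRotation hG.analytic
  im_eq_zero y z := by
    refine Complex.conj_eq_iff_im.1 ?_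
    have h := hG.conj_apply_conj y (-(Complex.I * z))
    rw [heven] at h
    simpa [_root_.wickRotation] using h

/-- Wick rotation of a solution of the minimal surface equation that is even in the
second variable gives a real solution of the Born–Infeld equation. -/
theorem wick_even_minimal_to_born_infeld (F : ℂ × ℂ → ℂ)
    (hF : AnalyticOnNhd ℂ F Set.univ)
    (hreal : ∀ x y : ℝ, (F ((x : ℂ), (y : ℂ))).im = 0)
    (heven : ∀ z w : ℂ, F (z, -w) = F (z, w))
    (hmin : ∀ x y : ℝ, SatisfiesMSE (fun x y : ℝ => (F ((x : ℂ), (y : ℂ))).re) x y) :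
    (∀ y z : ℝ, (F ((y : ℂ), Complex.I * z)).im = 0) ∧
    (∀ y z : ℝ,
      SatisfiesBIE (fun y z : ℝ => (F ((y : ℂ), Complex.I * z)).re) y z) := by
  have hG : IsRealEntire F := ⟨hF, hreal⟩
  have hH : IsRealEntire (wickRotation F) := hG.wickRotation heven
  refine ⟨hH.im_eq_zero, fun y z => ?_⟩
  change SatisfiesBIE (realRestriction (wickRotation F)) y z
  have hMSE := hG.complexMSE_eq_zero hmin y (Complex.I * z)
  rw [complexMSE] at hMSE
  rw [SatisfiesBIE, hH.partialX_realRestriction, hH.partialY_realRestriction,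
    hH.partialX.partialX_realRestriction, hH.partialX.partialY_realRestriction,
    hH.partialY.partialY_realRestriction, ← Complex.ofReal_inj]
  push_cast
  rw [hH.partialX.ofReal_realRestriction, hH.partialY.ofReal_realRestriction,
    hH.partialX.partialX.ofReal_realRestriction, hH.partialX.partialY.ofReal_realRestriction,
    hH.partialY.partialY.ofReal_realRestriction]
  have hX := analyticOnNhd_complexPartialX hF
  have hY := analyticOnNhd_complexPartialY hF
  rw [complexPartialX_wickRotation hF, complexPartialY_wickRotation hF,
    complexPartialX_wickRotation hX, complexPartialY_wickRotation hX,
    complexPartialY_const_mul (analyticOnNhd_wickRotation hY), complexPartialY_wickRotation hY]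
  simp only [wickRotation]
  linear_combination -hMSE + (complexPartialY (complexPartialY F) (y, Complex.I * z)
    * (1 + complexPartialX F (y, Complex.I * z) ^ 2)
    - 2 * complexPartialX F (y, Complex.I * z) * complexPartialY F (y, Complex.I * z)
      * complexPartialY (complexPartialX F) (y, Complex.I * z)
    + complexPartialY F (y, Complex.I * z) ^ 2
      * complexPartialX (complexPartialX F) (y, Complex.I * z)) * Complex.I_sq
end

section
/- For every θ ∈ (0, π/2), the function (x, y) ↦ φ(x, y; θ) satisfies the minimal surface equation at every point (x, y) ∈ ℝ² with sin(y·sin(θ/2)) ≠ 0 and cos(y·sin(θ/2)) ≠ 0. -/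
open Real

theorem phi_eq_arctan (x y θ : ℝ) :
    phi x y θ = -(cos (θ / 2))⁻¹ *
      arctan ((sinh (x * (sin (θ / 2) * cos (θ / 2))) * cos (y * sin (θ / 2))) /
        (cosh (x * (sin (θ / 2) * cos (θ / 2))) * sin (y * sin (θ / 2)))) := by
  have h : x * sin θ / 2 = x * (sin (θ / 2) * cos (θ / 2)) := by
    have h2 := sin_two_mul (θ / 2)
    rw [show 2 * (θ / 2) = θ by ring] at h2
    rw [h2]; ring
  rw [phi, h, tanh_eq_sinh_div_cosh, tan_eq_sin_div_cos, div_div_div_eq]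

theorem sinh_sq_add_sin_sq_pos {u v : ℝ} (hv : sin v ≠ 0) : 0 < sinh u ^ 2 + sin v ^ 2 := by
  positivity

theorem hasDerivAt_phi_fst {x y θ : ℝ} (hc : cos (θ / 2) ≠ 0)
    (hv : sin (y * sin (θ / 2)) ≠ 0) :
    HasDerivAt (fun t => phi t y θ)
      (-sin (θ / 2) * (sin (y * sin (θ / 2)) * cos (y * sin (θ / 2))) /
        (sinh (x * (sin (θ / 2) * cos (θ / 2))) ^ 2 + sin (y * sin (θ / 2)) ^ 2)) x := by
  simp only [phi_eq_arctan]
  generalize sin (θ / 2) = s at *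
  generalize cos (θ / 2) = c at *
  have hu : HasDerivAt (fun t : ℝ => t * (s * c)) (s * c) x := by
    simpa using (hasDerivAt_id x).mul_const (s * c)
  have hC := (cosh_pos (x * (s * c))).ne'
  have hd := (((hu.sinh.mul_const (cos (y * s))).div (hu.cosh.mul_const (sin (y * s)))
    (mul_ne_zero hC hv)).arctan).const_mul (-c⁻¹)
  refine hd.congr_deriv ?_
  have hD := (sinh_sq_add_sin_sq_pos (u := x * (s * c)) hv).ne'
  have h1 := cosh_sq (x * (s * c))
  have h2 := sin_sq_add_cos_sq (y * s)
  simp only [Pi.div_apply]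
  generalize cosh (x * (s * c)) = C at *
  generalize sinh (x * (s * c)) = S at *
  generalize sin (y * s) = p at *
  generalize cos (y * s) = q at *
  have hE : (C * p) ^ 2 + (S * q) ^ 2 = S ^ 2 + p ^ 2 := by
    linear_combination p ^ 2 * h1 + S ^ 2 * h2
  have hE' : 1 + (S * q / (C * p)) ^ 2 = (S ^ 2 + p ^ 2) / (C * p) ^ 2 := by
    rw [← hE]; field_simp
  rw [hE']
  field_simp
  linear_combination (-(s * q)) * h1

theorem hasDerivAt_phi_snd {x y θ : ℝ} (hv : sin (y * sin (θ / 2)) ≠ 0) :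
    HasDerivAt (fun t => phi x t θ)
      (sin (θ / 2) / cos (θ / 2) * (sinh (x * (sin (θ / 2) * cos (θ / 2))) *
          cosh (x * (sin (θ / 2) * cos (θ / 2)))) /
        (sinh (x * (sin (θ / 2) * cos (θ / 2))) ^ 2 + sin (y * sin (θ / 2)) ^ 2)) y := by
  simp only [phi_eq_arctan]
  generalize sin (θ / 2) = s at *
  generalize cos (θ / 2) = c at *
  have hu : HasDerivAt (fun t : ℝ => t * s) s y := by
    simpa using (hasDerivAt_id y).mul_const s
  have hC := (cosh_pos (x * (s * c))).ne'
  have hd := (((hu.cos.const_mul (sinh (x * (s * c)))).div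
    (hu.sin.const_mul (cosh (x * (s * c)))) (mul_ne_zero hC hv)).arctan).const_mul (-c⁻¹)
  refine hd.congr_deriv ?_
  have hD := (sinh_sq_add_sin_sq_pos (u := x * (s * c)) hv).ne'
  have h1 := cosh_sq (x * (s * c))
  have h2 := sin_sq_add_cos_sq (y * s)
  simp only [Pi.div_apply]
  generalize cosh (x * (s * c)) = C at *
  generalize sinh (x * (s * c)) = S at *
  generalize sin (y * s) = p at *
  generalize cos (y * s) = q at *
  have hE : (C * p) ^ 2 + (S * q) ^ 2 = S ^ 2 + p ^ 2 := by
    linear_combination p ^ 2 * h1 + S ^ 2 * h2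
  have hE' : 1 + (S * q / (C * p)) ^ 2 = (S ^ 2 + p ^ 2) / (C * p) ^ 2 := by
    rw [← hE]; field_simp
  rw [hE']
  field_simp
  linear_combination (s * S / c) * h2

/-- The family `φ(·, ·; θ)` satisfies the minimal surface equation. -/
theorem phi_satisfies_mse (θ : ℝ) (hθ0 : 0 < θ) (hθ1 : θ < Real.pi / 2)
    (x y : ℝ) (hsin : Real.sin (y * Real.sin (θ / 2)) ≠ 0)
    (hcos : Real.cos (y * Real.sin (θ / 2)) ≠ 0) :
    SatisfiesMSE (fun x y : ℝ => phi x y θ) x y := by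
  have hc : cos (θ / 2) ≠ 0 := (cos_pos_of_mem_Ioo ⟨by linarith, by linarith⟩).ne'
  have hX : ∀ a b, sin (b * sin (θ / 2)) ≠ 0 →
      partialX (fun x y => phi x y θ) a b = _ :=
    fun a b hb => (hasDerivAt_phi_fst (x := a) hc hb).deriv
  have hY : ∀ a b, sin (b * sin (θ / 2)) ≠ 0 →
      partialY (fun x y => phi x y θ) a b = _ :=
    fun a b hb => (hasDerivAt_phi_snd (x := a) hb).deriv
  have hnear : ∀ᶠ t in nhds y, sin (t * sin (θ / 2)) ≠ 0 :=
    (by fun_prop : Continuous fun t : ℝ => sin (t * sin (θ / 2))).continuousAt.eventually_ne hsin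
  have hXX := congrArg (fun f : ℝ → ℝ => deriv f x) (funext fun t => hX t y hsin)
  have hXY := Filter.EventuallyEq.deriv_eq (hnear.mono fun t ht => hX x t ht)
  have hYY := Filter.EventuallyEq.deriv_eq (hnear.mono fun t ht => hY x t ht)
  have hsc := sin_sq_add_cos_sq (θ / 2)
  unfold SatisfiesMSE
  rw [hX x y hsin, hY x y hsin]
  rw [show partialX (partialX fun x y => phi x y θ) x y = _ from hXX,
    show partialY (partialX fun x y => phi x y θ) x y = _ from hXY,
    show partialY (partialY fun x y => phi x y θ) x y = _ from hYY]
  clear hX hY hnear hXX hXY hYY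
  generalize sin (θ / 2) = s at *
  generalize cos (θ / 2) = c at *
  have hu : HasDerivAt (fun t : ℝ => t * (s * c)) (s * c) x := by
    simpa using (hasDerivAt_id x).mul_const (s * c)
  have hv : HasDerivAt (fun t : ℝ => t * s) s y := by
    simpa using (hasDerivAt_id y).mul_const s
  have hD := (sinh_sq_add_sin_sq_pos (u := x * (s * c)) hsin).ne'
  have hDx := (hu.sinh.pow 2).add_const (sin (y * s) ^ 2)
  have hDy := (hv.sin.pow 2).const_add (sinh (x * (s * c)) ^ 2)
  have hxx := ((hasDerivAt_const x (-s * (sin (y * s) * cos (y * s)))).fun_div hDx hD).deriv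
  have hxy := (((hv.sin.fun_mul hv.cos).const_mul (-s)).fun_div hDy hD).deriv
  have hyy := ((hasDerivAt_const y (s / c * (sinh (x * (s * c)) * cosh (x * (s * c))))).fun_div
    hDy hD).deriv
  simp only [Pi.pow_apply] at hxx hxy hyy
  rw [hxx, hxy, hyy]
  have h1 := cosh_sq (x * (s * c))
  have h2 := sin_sq_add_cos_sq (y * s)
  clear hxx hxy hyy hDx hDy hu hv
  generalize cosh (x * (s * c)) = C at *
  generalize sinh (x * (s * c)) = S at *
  generalize sin (y * s) = p at *
  generalize cos (y * s) = q at *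
  push_cast
  field_simp
  linear_combination 2 * s ^ 2 * p * q * S * C * c *
    ((S ^ 2 + p ^ 2) ^ 2 * hsc + s ^ 2 * S ^ 2 * (h1 - h2))
end

section
/- For every θ ∈ (0, π/2), the function (x, y) ↦ ψ(x, y; θ) satisfies the zero mean curvature equation at every point (x, y) ∈ ℝ² with cos(x·(sin θ)/2) ≠ 0 and y ≠ 0. -/
open Real

lemma sinh_sq_add_sin_sq_ne_zero {v : ℝ} (hv : v ≠ 0) (u : ℝ) :
    Real.sinh v ^ 2 + Real.sin u ^ 2 ≠ 0 := by
  have h : Real.sinh v ≠ 0 := by simpa using hv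
  positivity

lemma sinh_sq_add_sin_sq_eq (u v : ℝ) :
    Real.sinh v ^ 2 + Real.sin u ^ 2
      = Real.cos u ^ 2 * Real.sinh v ^ 2 + Real.sin u ^ 2 * Real.cosh v ^ 2 := by
  rw [Real.cosh_sq, Real.cos_sq']
  ring

lemma hasDerivAt_arctan_tan_div_tanh_left {u v : ℝ} (hu : Real.cos u ≠ 0) (hv : v ≠ 0) :
    HasDerivAt (fun t => Real.arctan (Real.tan t / Real.tanh v))
      (Real.cosh v * Real.sinh v / (Real.sinh v ^ 2 + Real.sin u ^ 2)) u := by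
  have hS : Real.sinh v ≠ 0 := by simpa using hv
  have hC : Real.cosh v ≠ 0 := (Real.cosh_pos v).ne'
  have hW := sinh_sq_add_sin_sq_ne_zero hv u
  refine ((Real.hasDerivAt_tan hu).div_const (Real.tanh v)).arctan.congr_deriv ?_
  rw [sinh_sq_add_sin_sq_eq] at hW ⊢
  rw [Real.tan_eq_sin_div_cos, Real.tanh_eq_sinh_div_cosh]
  field_simp

lemma hasDerivAt_arctan_tan_div_tanh_right {u v : ℝ} (hu : Real.cos u ≠ 0) (hv : v ≠ 0) :
    HasDerivAt (fun t => Real.arctan (Real.tan u / Real.tanh t))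
      (-(Real.sin u * Real.cos u) / (Real.sinh v ^ 2 + Real.sin u ^ 2)) v := by
  have hS : Real.sinh v ≠ 0 := by simpa using hv
  have hC : Real.cosh v ≠ 0 := (Real.cosh_pos v).ne'
  have hW := sinh_sq_add_sin_sq_ne_zero hv u
  have h := (((Real.hasDerivAt_cosh v).div (Real.hasDerivAt_sinh v) hS).const_mul
    (Real.tan u)).arctan
  have hfun : (fun t => Real.arctan (Real.tan u / Real.tanh t))
      = fun t => Real.arctan (Real.tan u * (Real.cosh / Real.sinh) t) := by
    funext t
    rw [Real.tanh_eq_sinh_div_cosh, Pi.div_apply, div_div_eq_mul_div, mul_div_assoc]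
  rw [hfun]
  refine h.congr_deriv ?_
  rw [sinh_sq_add_sin_sq_eq] at hW ⊢
  rw [Pi.div_apply, Real.tan_eq_sin_div_cos]
  field_simp
  rw [Real.cosh_sq]
  ring

lemma sin_half_pos {θ : ℝ} (hθ0 : 0 < θ) (hθ1 : θ < Real.pi / 2) : 0 < Real.sin (θ / 2) :=
  Real.sin_pos_of_pos_of_lt_pi (by linarith) (by linarith)

lemma cos_half_pos {θ : ℝ} (hθ0 : 0 < θ) (hθ1 : θ < Real.pi / 2) : 0 < Real.cos (θ / 2) :=
  Real.cos_pos_of_mem_Ioo ⟨by linarith, by linarith⟩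

lemma sin_div_two_eq (θ : ℝ) : Real.sin θ / 2 = Real.cos (θ / 2) * Real.sin (θ / 2) := by
  have h := Real.sin_two_mul (θ / 2)
  rw [mul_div_cancel₀ θ two_ne_zero] at h
  rw [h]
  ring

lemma hasDerivAt_mul_sin_div_two (θ x : ℝ) :
    HasDerivAt (fun t => t * Real.sin θ / 2) (Real.cos (θ / 2) * Real.sin (θ / 2)) x := by
  refine (((hasDerivAt_id x).mul_const (Real.sin θ)).div_const 2).congr_deriv ?_
  rw [one_mul, sin_div_two_eq]

lemma partialX_psi {θ : ℝ} (hθ0 : 0 < θ) (hθ1 : θ < Real.pi / 2) {x y : ℝ}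
    (hcos : Real.cos (x * Real.sin θ / 2) ≠ 0) (hy : y ≠ 0) :
    partialX (fun x y : ℝ => psi x y θ) x y
      = Real.sin (θ / 2) * (Real.cosh (y * Real.sin (θ / 2)) * Real.sinh (y * Real.sin (θ / 2)))
        / (Real.sinh (y * Real.sin (θ / 2)) ^ 2 + Real.sin (x * Real.sin θ / 2) ^ 2) := by
  have hb := (sin_half_pos hθ0 hθ1).ne'
  have hk := (cos_half_pos hθ0 hθ1).ne'
  refine HasDerivAt.deriv ((((hasDerivAt_arctan_tan_div_tanh_left hcos
    (mul_ne_zero hy hb)).comp x (hasDerivAt_mul_sin_div_two θ x)).const_mul _).congr_deriv ?_)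
  field_simp

lemma partialY_psi {θ : ℝ} (hθ0 : 0 < θ) (hθ1 : θ < Real.pi / 2) {x y : ℝ}
    (hcos : Real.cos (x * Real.sin θ / 2) ≠ 0) (hy : y ≠ 0) :
    partialY (fun x y : ℝ => psi x y θ) x y
      = -(Real.sin (θ / 2) / Real.cos (θ / 2))
          * (Real.sin (x * Real.sin θ / 2) * Real.cos (x * Real.sin θ / 2))
        / (Real.sinh (y * Real.sin (θ / 2)) ^ 2 + Real.sin (x * Real.sin θ / 2) ^ 2) := by
  have hb := (sin_half_pos hθ0 hθ1).ne'
  have hk := (cos_half_pos hθ0 hθ1).ne'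
  refine HasDerivAt.deriv ((((hasDerivAt_arctan_tan_div_tanh_right hcos
    (mul_ne_zero hy hb)).comp y (hasDerivAt_mul_const _)).const_mul _).congr_deriv ?_)
  field_simp

lemma partialX_partialX_psi {θ : ℝ} (hθ0 : 0 < θ) (hθ1 : θ < Real.pi / 2) {x y : ℝ}
    (hcos : Real.cos (x * Real.sin θ / 2) ≠ 0) (hy : y ≠ 0) :
    partialX (partialX (fun x y : ℝ => psi x y θ)) x y
      = -2 * Real.sin (θ / 2) ^ 2 * Real.cos (θ / 2)
          * (Real.cosh (y * Real.sin (θ / 2)) * Real.sinh (y * Real.sin (θ / 2)))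
          * (Real.sin (x * Real.sin θ / 2) * Real.cos (x * Real.sin θ / 2))
        / (Real.sinh (y * Real.sin (θ / 2)) ^ 2 + Real.sin (x * Real.sin θ / 2) ^ 2) ^ 2 := by
  have hW := sinh_sq_add_sin_sq_ne_zero (mul_ne_zero hy (sin_half_pos hθ0 hθ1).ne')
    (x * Real.sin θ / 2)
  have hev : ∀ᶠ t in nhds x, Real.cos (t * Real.sin θ / 2) ≠ 0 :=
    ContinuousAt.eventually_ne (by fun_prop) hcos
  have heq := hev.mono fun t ht => partialX_psi hθ0 hθ1 ht hy
  refine (Filter.EventuallyEq.deriv_eq heq).trans (HasDerivAt.deriv ?_)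
  refine ((hasDerivAt_const x _).div
    (((hasDerivAt_mul_sin_div_two θ x).sin.pow 2).const_add _) hW).congr_deriv ?_
  simp only [Pi.pow_apply]
  field_simp
  ring

lemma partialY_partialX_psi {θ : ℝ} (hθ0 : 0 < θ) (hθ1 : θ < Real.pi / 2) {x y : ℝ}
    (hcos : Real.cos (x * Real.sin θ / 2) ≠ 0) (hy : y ≠ 0) :
    partialY (partialX (fun x y : ℝ => psi x y θ)) x y
      = Real.sin (θ / 2) ^ 2
          * ((Real.cosh (y * Real.sin (θ / 2)) ^ 2 + Real.sinh (y * Real.sin (θ / 2)) ^ 2)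
              * (Real.sinh (y * Real.sin (θ / 2)) ^ 2 + Real.sin (x * Real.sin θ / 2) ^ 2)
            - 2 * (Real.cosh (y * Real.sin (θ / 2)) * Real.sinh (y * Real.sin (θ / 2))) ^ 2)
        / (Real.sinh (y * Real.sin (θ / 2)) ^ 2 + Real.sin (x * Real.sin θ / 2) ^ 2) ^ 2 := by
  have hW := sinh_sq_add_sin_sq_ne_zero (mul_ne_zero hy (sin_half_pos hθ0 hθ1).ne')
    (x * Real.sin θ / 2)
  have heq := (eventually_ne_nhds hy).mono fun t ht => partialX_psi hθ0 hθ1 hcos ht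
  have hlin : HasDerivAt (fun t : ℝ => t * Real.sin (θ / 2)) (Real.sin (θ / 2)) y :=
    hasDerivAt_mul_const _
  refine (Filter.EventuallyEq.deriv_eq heq).trans (HasDerivAt.deriv ?_)
  refine (((hlin.cosh.mul hlin.sinh).const_mul _).div
    ((hlin.sinh.pow 2).add_const _) hW).congr_deriv ?_
  simp only [Pi.mul_apply, Pi.pow_apply]
  field_simp
  ring

lemma partialY_partialY_psi {θ : ℝ} (hθ0 : 0 < θ) (hθ1 : θ < Real.pi / 2) {x y : ℝ}
    (hcos : Real.cos (x * Real.sin θ / 2) ≠ 0) (hy : y ≠ 0) :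
    partialY (partialY (fun x y : ℝ => psi x y θ)) x y
      = 2 * (Real.sin (θ / 2) ^ 2 / Real.cos (θ / 2))
          * (Real.cosh (y * Real.sin (θ / 2)) * Real.sinh (y * Real.sin (θ / 2)))
          * (Real.sin (x * Real.sin θ / 2) * Real.cos (x * Real.sin θ / 2))
        / (Real.sinh (y * Real.sin (θ / 2)) ^ 2 + Real.sin (x * Real.sin θ / 2) ^ 2) ^ 2 := by
  have hW := sinh_sq_add_sin_sq_ne_zero (mul_ne_zero hy (sin_half_pos hθ0 hθ1).ne')
    (x * Real.sin θ / 2)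
  have hk := (cos_half_pos hθ0 hθ1).ne'
  have heq := (eventually_ne_nhds hy).mono fun t ht => partialY_psi hθ0 hθ1 hcos ht
  have hlin : HasDerivAt (fun t : ℝ => t * Real.sin (θ / 2)) (Real.sin (θ / 2)) y :=
    hasDerivAt_mul_const _
  refine (Filter.EventuallyEq.deriv_eq heq).trans (HasDerivAt.deriv ?_)
  refine ((hasDerivAt_const y _).div ((hlin.sinh.pow 2).add_const _) hW).congr_deriv ?_
  simp only [Pi.pow_apply]
  field_simp
  ring

/-- The family `ψ(·, ·; θ)` satisfies the zero mean curvature equation. -/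
theorem psi_satisfies_zmc (θ : ℝ) (hθ0 : 0 < θ) (hθ1 : θ < Real.pi / 2)
    (x y : ℝ) (hcos : Real.cos (x * Real.sin θ / 2) ≠ 0) (hy : y ≠ 0) :
    SatisfiesZMC (fun x y : ℝ => psi x y θ) x y := by
  have hW := sinh_sq_add_sin_sq_ne_zero (mul_ne_zero hy (sin_half_pos hθ0 hθ1).ne')
    (x * Real.sin θ / 2)
  have hk := (cos_half_pos hθ0 hθ1).ne'
  rw [SatisfiesZMC, partialX_partialX_psi hθ0 hθ1 hcos hy, partialY_partialX_psi hθ0 hθ1 hcos hy,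
    partialY_partialY_psi hθ0 hθ1 hcos hy, partialX_psi hθ0 hθ1 hcos hy,
    partialY_psi hθ0 hθ1 hcos hy]
  have hC := Real.cosh_sq (y * Real.sin (θ / 2))
  have hc := Real.sin_sq_add_cos_sq (x * Real.sin θ / 2)
  have hbk := Real.sin_sq_add_cos_sq (θ / 2)
  generalize Real.cosh (y * Real.sin (θ / 2)) = C at *
  generalize Real.sinh (y * Real.sin (θ / 2)) = S at *
  generalize Real.sin (x * Real.sin θ / 2) = s at *
  generalize Real.cos (x * Real.sin θ / 2) = c at *
  generalize Real.sin (θ / 2) = b at *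
  generalize Real.cos (θ / 2) = k at *
  have key : (S ^ 2 + s ^ 2) ^ 2 * (1 - k ^ 2) + b ^ 2 * (C ^ 2 * S ^ 2
      - (C ^ 2 + S ^ 2) * (S ^ 2 + s ^ 2) + s ^ 2 * c ^ 2) = 0 := by
    rw [hC, show c ^ 2 = 1 - s ^ 2 by linarith, show k ^ 2 = 1 - b ^ 2 by linarith]
    ring
  trans 2 * b ^ 2 * C * S * s * c / (k * (S ^ 2 + s ^ 2) ^ 4)
    * ((S ^ 2 + s ^ 2) ^ 2 * (1 - k ^ 2) + b ^ 2 * (C ^ 2 * S ^ 2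
      - (C ^ 2 + S ^ 2) * (S ^ 2 + s ^ 2) + s ^ 2 * c ^ 2))
  · field_simp
    ring
  · rw [key, mul_zero]
end

section
/- For every θ ∈ (0, π/2), the function (y, z) ↦ χ(y, z; θ) satisfies the Born–Infeld equation at every point (y, z) ∈ ℝ² with y ≠ 0 and |tanh(z·(sin θ)/2)| < |tanh(y·sin(θ/2))|. -/
open Real

theorem hasDerivAt_artanhR {x : ℝ} (hx : x ^ 2 < 1) :
    HasDerivAt artanhR (1 / (1 - x ^ 2)) x := by
  obtain ⟨h₁, h₂⟩ := abs_lt.mp ((sq_lt_one_iff_abs_lt_one x).mp hx)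
  have hp : 1 + x ≠ 0 := by linarith
  have hm : 1 - x ≠ 0 := by linarith
  have hq : 1 - x ^ 2 ≠ 0 := by linarith
  have h := ((((hasDerivAt_id x).const_add 1).div ((hasDerivAt_id x).const_sub 1) hm).log
    (div_ne_zero hp hm)).const_mul (1 / 2)
  refine h.congr_deriv ?_
  simp only [id, Pi.div_apply]
  field_simp
  ring

theorem hasDerivAt_tanh (x : ℝ) : HasDerivAt Real.tanh (1 - Real.tanh x ^ 2) x := by
  have hc : Real.cosh x ≠ 0 := (Real.cosh_pos x).ne'
  have h := (Real.hasDerivAt_sinh x).div (Real.hasDerivAt_cosh x) hc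
  have he : Real.sinh / Real.cosh = Real.tanh := by
    ext t
    simp [Real.tanh_eq_sinh_div_cosh]
  rw [he] at h
  refine h.congr_deriv ?_
  rw [Real.tanh_eq_sinh_div_cosh]
  field_simp

theorem hasDerivAt_tanh_mul_const (a x : ℝ) :
    HasDerivAt (fun y => Real.tanh (y * a)) (a * (1 - Real.tanh (x * a) ^ 2)) x := by
  refine ((hasDerivAt_tanh (x * a)).comp x (hasDerivAt_mul_const a)).congr_deriv ?_
  ring

section ScherkHeight

variable {a b c y z : ℝ}

theorem sq_div_lt_one_of_sq_lt_sq {s t : ℝ} (h : s ^ 2 < t ^ 2) : (s / t) ^ 2 < 1 := by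
  rw [div_pow, div_lt_one ((sq_nonneg s).trans_lt h)]
  exact h

/-- The height function with independent frequencies `a`, `b` and scale `c`. -/
noncomputable def scherkHeight (a b c y z : ℝ) : ℝ :=
  c⁻¹ * artanhR (Real.tanh (z * b) / Real.tanh (y * a))

theorem partialX_scherkHeight (h : Real.tanh (z * b) ^ 2 < Real.tanh (y * a) ^ 2) :
    partialX (scherkHeight a b c) y z = -(c⁻¹ * a) * Real.tanh (z * b) *
      ((1 - Real.tanh (y * a) ^ 2) / (Real.tanh (y * a) ^ 2 - Real.tanh (z * b) ^ 2)) := by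
  have ht : Real.tanh (y * a) ≠ 0 := fun h0 => by
    rw [h0] at h; nlinarith [sq_nonneg (Real.tanh (z * b))]
  have hD : Real.tanh (y * a) ^ 2 - Real.tanh (z * b) ^ 2 ≠ 0 := (sub_pos.mpr h).ne'
  have hd := ((hasDerivAt_artanhR (sq_div_lt_one_of_sq_lt_sq h)).comp y
    ((hasDerivAt_const y (Real.tanh (z * b))).div (hasDerivAt_tanh_mul_const a y) ht)).const_mul c⁻¹
  refine hd.deriv.trans ?_
  have hq : 1 - (Real.tanh (z * b) / Real.tanh (y * a)) ^ 2 =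
      (Real.tanh (y * a) ^ 2 - Real.tanh (z * b) ^ 2) / Real.tanh (y * a) ^ 2 := by
    field_simp
  rw [hq]
  generalize Real.tanh (y * a) ^ 2 - Real.tanh (z * b) ^ 2 = D at hD
  field_simp
  ring

theorem partialY_scherkHeight (h : Real.tanh (z * b) ^ 2 < Real.tanh (y * a) ^ 2) :
    partialY (scherkHeight a b c) y z = c⁻¹ * b * Real.tanh (y * a) *
      ((1 - Real.tanh (z * b) ^ 2) / (Real.tanh (y * a) ^ 2 - Real.tanh (z * b) ^ 2)) := by
  have ht : Real.tanh (y * a) ≠ 0 := fun h0 => by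
    rw [h0] at h; nlinarith [sq_nonneg (Real.tanh (z * b))]
  have hD : Real.tanh (y * a) ^ 2 - Real.tanh (z * b) ^ 2 ≠ 0 := (sub_pos.mpr h).ne'
  have hd := ((hasDerivAt_artanhR (sq_div_lt_one_of_sq_lt_sq h)).comp z
    ((hasDerivAt_tanh_mul_const b z).div_const (Real.tanh (y * a)))).const_mul c⁻¹
  refine hd.deriv.trans ?_
  have hq : 1 - (Real.tanh (z * b) / Real.tanh (y * a)) ^ 2 =
      (Real.tanh (y * a) ^ 2 - Real.tanh (z * b) ^ 2) / Real.tanh (y * a) ^ 2 := by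
    field_simp
  rw [hq]
  generalize Real.tanh (y * a) ^ 2 - Real.tanh (z * b) ^ 2 = D at hD
  field_simp

theorem eventually_tanh_sq_lt_left (h : Real.tanh (z * b) ^ 2 < Real.tanh (y * a) ^ 2) :
    ∀ᶠ t in nhds y, Real.tanh (z * b) ^ 2 < Real.tanh (t * a) ^ 2 :=
  continuousAt_const.eventually_lt ((hasDerivAt_tanh_mul_const a y).continuousAt.pow 2) h

theorem eventually_tanh_sq_lt_right (h : Real.tanh (z * b) ^ 2 < Real.tanh (y * a) ^ 2) :
    ∀ᶠ t in nhds z, Real.tanh (t * b) ^ 2 < Real.tanh (y * a) ^ 2 :=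
  ((hasDerivAt_tanh_mul_const b z).continuousAt.pow 2).eventually_lt continuousAt_const h

theorem partialX_partialX_scherkHeight (h : Real.tanh (z * b) ^ 2 < Real.tanh (y * a) ^ 2) :
    partialX (partialX (scherkHeight a b c)) y z = 2 * c⁻¹ * a ^ 2 *
      Real.tanh (z * b) * Real.tanh (y * a) *
      ((1 - Real.tanh (z * b) ^ 2) * (1 - Real.tanh (y * a) ^ 2) /
        (Real.tanh (y * a) ^ 2 - Real.tanh (z * b) ^ 2) ^ 2) := by
  have hD : Real.tanh (y * a) ^ 2 - Real.tanh (z * b) ^ 2 ≠ 0 := (sub_pos.mpr h).ne'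
  have ht := (hasDerivAt_tanh_mul_const a y).pow 2
  have hd := ((ht.const_sub 1).div (ht.sub_const (Real.tanh (z * b) ^ 2)) hD).const_mul
    (-(c⁻¹ * a) * Real.tanh (z * b))
  have he := (eventually_tanh_sq_lt_left h).mono fun t => partialX_scherkHeight (c := c)
  refine ((Filter.EventuallyEq.deriv_eq he).trans hd.deriv).trans ?_
  simp only [Pi.pow_apply]
  field_simp
  push_cast
  ring

theorem partialY_partialX_scherkHeight (h : Real.tanh (z * b) ^ 2 < Real.tanh (y * a) ^ 2) :
    partialY (partialX (scherkHeight a b c)) y z = -(c⁻¹ * a * b) *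
      (Real.tanh (y * a) ^ 2 + Real.tanh (z * b) ^ 2) *
      ((1 - Real.tanh (z * b) ^ 2) * (1 - Real.tanh (y * a) ^ 2) /
        (Real.tanh (y * a) ^ 2 - Real.tanh (z * b) ^ 2) ^ 2) := by
  have hD : Real.tanh (y * a) ^ 2 - Real.tanh (z * b) ^ 2 ≠ 0 := (sub_pos.mpr h).ne'
  have hs := hasDerivAt_tanh_mul_const b z
  have hd := (hs.const_mul (-(c⁻¹ * a))).mul
    ((hasDerivAt_const z (1 - Real.tanh (y * a) ^ 2)).div
      ((hs.pow 2).const_sub (Real.tanh (y * a) ^ 2)) hD)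
  have he := (eventually_tanh_sq_lt_right h).mono fun t => partialX_scherkHeight (c := c)
  refine ((Filter.EventuallyEq.deriv_eq he).trans hd.deriv).trans ?_
  simp only [Pi.pow_apply, Pi.div_apply]
  field_simp
  push_cast
  ring

theorem partialY_partialY_scherkHeight (h : Real.tanh (z * b) ^ 2 < Real.tanh (y * a) ^ 2) :
    partialY (partialY (scherkHeight a b c)) y z = 2 * c⁻¹ * b ^ 2 *
      Real.tanh (z * b) * Real.tanh (y * a) *
      ((1 - Real.tanh (z * b) ^ 2) * (1 - Real.tanh (y * a) ^ 2) /
        (Real.tanh (y * a) ^ 2 - Real.tanh (z * b) ^ 2) ^ 2) := by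
  have hD : Real.tanh (y * a) ^ 2 - Real.tanh (z * b) ^ 2 ≠ 0 := (sub_pos.mpr h).ne'
  have hs := (hasDerivAt_tanh_mul_const b z).pow 2
  have hd := ((hs.const_sub 1).div (hs.const_sub (Real.tanh (y * a) ^ 2)) hD).const_mul
    (c⁻¹ * b * Real.tanh (y * a))
  have he := (eventually_tanh_sq_lt_right h).mono fun t => partialY_scherkHeight (c := c)
  refine ((Filter.EventuallyEq.deriv_eq he).trans hd.deriv).trans ?_
  simp only [Pi.pow_apply]
  field_simp
  push_cast
  ring

theorem satisfiesBIE_scherkHeight (hc : c ≠ 0) (hac : a ^ 2 + c ^ 2 = 1)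
    (h : Real.tanh (z * (a * c)) ^ 2 < Real.tanh (y * a) ^ 2) :
    SatisfiesBIE (scherkHeight a (a * c) c) y z := by
  have hD : Real.tanh (y * a) ^ 2 - Real.tanh (z * (a * c)) ^ 2 ≠ 0 := (sub_pos.mpr h).ne'
  rw [SatisfiesBIE, partialX_partialX_scherkHeight h, partialY_partialX_scherkHeight h,
    partialY_partialY_scherkHeight h, partialX_scherkHeight h, partialY_scherkHeight h]
  generalize Real.tanh (z * (a * c)) = s at hD ⊢
  generalize Real.tanh (y * a) = t at hD ⊢
  field_simp
  have hc2 : c ^ 2 = 1 - a ^ 2 := by linarith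
  ring_nf
  simp only [hc2]
  ring

end ScherkHeight

/-- The family `χ(·, ·; θ)` satisfies the Born–Infeld equation. -/
theorem chi_satisfies_bie (θ : ℝ) (hθ0 : 0 < θ) (hθ1 : θ < Real.pi / 2)
    (y z : ℝ) (hy : y ≠ 0)
    (hlt : |Real.tanh (z * Real.sin θ / 2)| < |Real.tanh (y * Real.sin (θ / 2))|) :
    SatisfiesBIE (fun y z : ℝ => chi y z θ) y z := by
  have hb : Real.sin θ / 2 = Real.sin (θ / 2) * Real.cos (θ / 2) := by
    have h2 := Real.sin_two_mul (θ / 2)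
    rw [mul_div_cancel₀ θ two_ne_zero] at h2
    linarith
  have hc : Real.cos (θ / 2) ≠ 0 :=
    (Real.cos_pos_of_mem_Ioo ⟨by linarith [Real.pi_pos], by linarith⟩).ne'
  have hfun : (fun y z : ℝ => chi y z θ) = scherkHeight (Real.sin (θ / 2))
      (Real.sin (θ / 2) * Real.cos (θ / 2)) (Real.cos (θ / 2)) := by
    ext y z
    rw [chi, scherkHeight, mul_div_assoc, hb]
  rw [mul_div_assoc, hb] at hlt
  rw [hfun]
  exact satisfiesBIE_scherkHeight hc (Real.sin_sq_add_cos_sq _) (sq_lt_sq.mpr hlt)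
end
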